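/- arXiv:1005.1696 — 2 statements merged into one kernel-verified Lean document; each statement's English description precedes it below -/
import Mathlib

section
/- Let P be a polynomial with complex coefficients of degree 3, and suppose there exist a nonzero entire function w with w''(z) + P(z)·w(z) = 0 for all z ∈ ℂ and a natural number n such that w has exactly 2n zeros in ℂ \ ℝ. Then there exist α ∈ ℝ \ {0}, β ∈ ℝ and a, λ ∈ ℝ such that α²·P(α z + β) = −(z³ − a·z + λ) for all z ∈ ℂ, and the function W(z) := w(α z + β) is an eigenfunction of the PT-cubic problem at a with eigenvalue λ (that is, W(i t) → 0 as t → +∞ and t → −∞), W has exactly 2n zeros in ℂ \ ℝ, and W has infinitely many real zeros. -/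
open Complex Filter

/-- `w` is an eigenfunction of the PT-cubic problem at `a` with eigenvalue `lam`. -/
def PTCubicEigenfunction (a lam : ℝ) (w : ℂ → ℂ) : Prop :=
  w ≠ 0 ∧ Differentiable ℂ w ∧
    (∀ z : ℂ, deriv (deriv w) z = (z ^ 3 - (a : ℂ) * z + (lam : ℂ)) * w z) ∧
    Tendsto (fun t : ℝ => w ((t : ℂ) * Complex.I)) atTop (nhds 0) ∧
    Tendsto (fun t : ℝ => w ((t : ℂ) * Complex.I)) atBot (nhds 0)

/-- On a disc where `‖q‖ ≤ M²`, of radius at most `1 / M`, a solution of `w'' = q w` is bounded in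
terms of its initial data at the centre. -/
theorem norm_le_of_deriv_deriv_eq {w q : ℂ → ℂ} (hw : Differentiable ℂ w)
    (hode : ∀ z, HasDerivAt (deriv w) (q z * w z) z) {z₀ : ℂ} {M ρ : ℝ} (hM : 0 < M)
    (hMρ : M * ρ ≤ 1) (hq : ∀ z ∈ Metric.ball z₀ ρ, ‖q z‖ ≤ M ^ 2) {z : ℂ}
    (hz : z ∈ Metric.ball z₀ ρ) :
    ‖w z‖ ≤ max ‖w z₀‖ (‖deriv w z₀‖ / M) * Real.exp 1 := by
  set u := z - z₀ with hu
  have huρ : ‖u‖ < ρ := by simpa [hu, dist_eq_norm] using hz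
  have hMu : M * ‖u‖ ≤ 1 := le_trans (by gcongr) hMρ
  set v : ℝ → ℂ × ℂ := fun t => (w (z₀ + t * u), deriv w (z₀ + t * u) / M) with hv
  set v' : ℝ → ℂ × ℂ := fun t =>
    (deriv w (z₀ + t * u) * u, q (z₀ + t * u) * w (z₀ + t * u) * u / M) with hv'
  have hline : ∀ t : ℝ, HasDerivAt (fun t : ℝ => z₀ + (t : ℂ) * u) u t := fun t => by
    simpa using ((hasDerivAt_id t).ofReal_comp.mul_const u).const_add z₀
  have hvd : ∀ t, HasDerivAt v (v' t) t := fun t =>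
    (((hw _).hasDerivAt).comp t (hline t)).prodMk (((hode _).comp t (hline t)).div_const _)
  have key := norm_le_gronwallBound_of_norm_deriv_right_le (f := v) (f' := v') (δ := ‖v 0‖)
    (K := 1) (ε := 0) (a := 0) (b := 1) (fun t _ => (hvd t).continuousAt.continuousWithinAt)
    (fun t _ => (hvd t).hasDerivWithinAt) le_rfl (fun t ht => ?_) 1 (by simp)
  · rw [gronwallBound_ε0] at key
    have h1 : ‖w z‖ ≤ ‖v 1‖ := by
      have : w z = (v 1).1 := by simp [hv, hu]
      rw [this]; exact norm_fst_le _
    have h0 : ‖v 0‖ = max ‖w z₀‖ (‖deriv w z₀‖ / M) := by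
      simp [hv, Prod.norm_def, abs_of_pos hM]
    rw [h0] at key
    simpa using h1.trans key
  · have h1 : ‖w (z₀ + t * u)‖ ≤ ‖v t‖ := norm_fst_le (v t)
    have h2 : ‖deriv w (z₀ + t * u)‖ / M ≤ ‖v t‖ := by
      simp [hv, abs_of_pos hM]
    have hqt : ‖q (z₀ + t * u)‖ ≤ M ^ 2 := by
      apply hq
      simp only [Metric.mem_ball, dist_eq_norm, add_sub_cancel_left, norm_mul, norm_real,
        Real.norm_eq_abs, abs_of_nonneg ht.1]
      nlinarith [ht.2, norm_nonneg u]
    have hvn := norm_nonneg (v t)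
    rw [one_mul, add_zero, Prod.norm_def]
    refine max_le ?_ ?_
    · simp only [hv', norm_mul]
      rw [div_le_iff₀ hM] at h2
      calc _ ≤ ‖v t‖ * M * ‖u‖ := by gcongr
        _ = ‖v t‖ * (M * ‖u‖) := by ring
        _ ≤ ‖v t‖ := mul_le_of_le_one_right hvn hMu
    · simp only [hv', norm_mul, norm_div, norm_real, Real.norm_eq_abs, abs_of_pos hM]
      rw [div_le_iff₀ hM]
      calc _ ≤ M ^ 2 * ‖v t‖ * ‖u‖ := by gcongr
        _ = (‖v t‖ * M) * (M * ‖u‖) := by ring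
        _ ≤ ‖v t‖ * M := mul_le_of_le_one_right (by positivity) hMu

/-- The logarithmic derivative of a zero-free function on a disc is controlled by the growth of the
function relative to its value at the centre. -/
theorem norm_logDeriv_le_of_norm_le {w : ℂ → ℂ} (hw : Differentiable ℂ w) {z₀ : ℂ} {ρ A : ℝ}
    (hρ : 0 < ρ) (hA : 0 < A) (h0 : ∀ z ∈ Metric.ball z₀ ρ, w z ≠ 0)
    (hle : ∀ z ∈ Metric.ball z₀ ρ, ‖w z‖ ≤ ‖w z₀‖ * Real.exp A) :
    ‖deriv w z₀ / w z₀‖ ≤ 4 * A / ρ := by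
  have hz₀ : z₀ ∈ Metric.ball z₀ ρ := Metric.mem_ball_self hρ
  have hdiff : DifferentiableOn ℂ (fun z => deriv w z / w z) (Metric.ball z₀ ρ) :=
    (hw.contDiff (n := 2)).differentiable_deriv_two.differentiableOn.div hw.differentiableOn h0
  obtain ⟨g, hg0, hg⟩ := hdiff.isExactOn_ball.with_val_at z₀ 0
  have hexp : ∀ z ∈ Metric.ball z₀ ρ, w z = w z₀ * exp (g z) := by
    intro z hz
    have hd : ∀ x ∈ Metric.ball z₀ ρ, HasDerivAt (fun z => w z * exp (-g z)) 0 x := by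
      intro x hx
      refine ((hw x).hasDerivAt.mul (hg x hx).neg.cexp).congr_deriv ?_
      have := h0 x hx
      field_simp
      ring
    have hc := (convex_ball z₀ ρ).is_const_of_fderivWithin_eq_zero (𝕜 := ℂ)
      (fun x hx => (hd x hx).differentiableAt.differentiableWithinAt)
      (fun x hx => by
        rw [fderivWithin_of_isOpen Metric.isOpen_ball hx, ← toSpanSingleton_deriv, (hd x hx).deriv]
        simp) hz hz₀
    simp only [hg0, neg_zero, exp_zero, mul_one] at hc
    rw [← hc, mul_assoc, ← exp_add]
    simp
  have hre : ∀ z ∈ Metric.ball z₀ ρ, (g z).re ≤ A := by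
    intro z hz
    have h := hle z hz
    rw [hexp z hz, norm_mul, norm_exp] at h
    exact Real.exp_le_exp.1 (le_of_mul_le_mul_left h (norm_pos_iff.2 (h0 z₀ hz₀)))
  have hmem : ∀ u ∈ Metric.ball (0 : ℂ) ρ, z₀ + u ∈ Metric.ball z₀ ρ := by
    intro u hu
    simpa using hu
  have hfd : ∀ u ∈ Metric.ball (0 : ℂ) ρ, DifferentiableAt ℂ (fun u => g (z₀ + u)) u :=
    fun u hu => ((hg _ (hmem u hu)).comp_const_add z₀ u).differentiableAt
  have hbc : ∀ u ∈ Metric.sphere (0 : ℂ) (ρ / 2), ‖g (z₀ + u)‖ ≤ 2 * A := by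
    intro u hu
    have hun : ‖u‖ = ρ / 2 := by simpa using hu
    have := borelCaratheodory_zero (f := fun u => g (z₀ + u)) hA
      (fun u hu => (hfd u hu).differentiableWithinAt)
      (fun u hu => hre _ (hmem u hu)) hρ (z := u) (by simp [hun, hρ]) (by simpa using hg0)
    rw [hun] at this
    convert this using 1
    field_simp
    ring
  have hsub : Metric.closedBall (0 : ℂ) (ρ / 2) ⊆ Metric.ball 0 ρ :=
    Metric.closedBall_subset_ball (by linarith)
  have hcau := norm_deriv_le_of_forall_mem_sphere_norm_le (c := (0 : ℂ)) (R := ρ / 2)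
    (f := fun u => g (z₀ + u)) (by positivity)
    (DifferentiableOn.diffContOnCl fun u hu => (hfd u (hsub
      (Metric.closure_ball_subset_closedBall hu))).differentiableWithinAt) hbc
  have hderiv : HasDerivAt (fun u => g (z₀ + u)) (deriv w z₀ / w z₀) 0 := by
    have := hg z₀ hz₀
    exact HasDerivAt.comp_const_add z₀ 0 (by simpa using this)
  rw [hderiv.deriv] at hcau
  convert hcau using 1
  field_simp
  ring

/-- Near a zero-free disc of radius `1 / M`, the logarithmic derivative of a solution of
`w'' = q w` with `‖q‖ ≤ M²` is at most a constant times `M`. -/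
theorem norm_logDeriv_le_of_deriv_deriv_eq {w q : ℂ → ℂ} (hw : Differentiable ℂ w)
    (hode : ∀ z, HasDerivAt (deriv w) (q z * w z) z) {z₀ : ℂ} {M : ℝ} (hM : 1 ≤ M)
    (h0 : ∀ z ∈ Metric.ball z₀ 1, w z ≠ 0) (hq : ∀ z ∈ Metric.ball z₀ 1, ‖q z‖ ≤ M ^ 2) :
    ‖deriv w z₀ / w z₀‖ ≤ 24 * M := by
  have hM0 : 0 < M := by linarith
  set x := ‖deriv w z₀ / w z₀‖ / M with hx
  by_contra! hcon
  have hx24 : 24 < x := by rwa [hx, lt_div_iff₀ hM0]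
  have hw0 : w z₀ ≠ 0 := h0 _ (Metric.mem_ball_self one_pos)
  have hsub : Metric.ball z₀ (1 / M) ⊆ Metric.ball z₀ 1 :=
    Metric.ball_subset_ball (by rw [div_le_one hM0]; exact hM)
  have hmax : max ‖w z₀‖ (‖deriv w z₀‖ / M) = ‖w z₀‖ * x := by
    have : ‖deriv w z₀‖ / M = ‖w z₀‖ * x := by
      have := norm_ne_zero_iff.2 hw0
      rw [hx, norm_div]; field_simp
    rw [this, max_eq_right]
    exact le_mul_of_one_le_right (norm_nonneg _) (by linarith)
  have hlogpos : 0 < Real.log x := Real.log_pos (by linarith)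
  have hb := norm_logDeriv_le_of_norm_le hw (z₀ := z₀) (ρ := 1 / M) (A := Real.log x + 1)
    (by positivity) (by positivity) (fun z hz => h0 z (hsub hz)) (fun z hz => by
      have := norm_le_of_deriv_deriv_eq hw hode hM0 (by field_simp; exact le_rfl)
        (fun z hz => hq z (hsub hz)) hz
      rwa [Real.exp_add, Real.exp_log (show 0 < x by linarith), ← mul_assoc, ← hmax])
  have hb' : x ≤ 4 * (Real.log x + 1) := by
    rw [hx, div_le_iff₀ hM0]
    rw [div_div_eq_mul_div, div_one] at hb
    exact hb
  have hlog8 : Real.log 8 ≤ 3 := by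
    rw [show (8 : ℝ) = 2 ^ 3 by norm_num, Real.log_pow]
    have := Real.log_two_lt_d9
    push_cast; linarith
  have hlog : Real.log x = Real.log (x / 8) + Real.log 8 := by
    rw [← Real.log_mul (by positivity) (by norm_num)]; congr 1; ring
  have := Real.log_le_sub_one_of_pos (show 0 < x / 8 by linarith)
  linarith

/-- On a zero-free disc of radius `3`, the logarithmic derivative `r` of a solution of `w'' = q w`
with `q` cubic satisfies `r² = c z³ + O(|z|²)`. -/
theorem exists_forall_norm_logDeriv_sq_sub_le {w : ℂ → ℂ} (hw : Differentiable ℂ w)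
    {c c₂ c₁ c₀ : ℂ}
    (hode : ∀ z, HasDerivAt (deriv w) ((c * z ^ 3 + c₂ * z ^ 2 + c₁ * z + c₀) * w z) z) :
    ∃ K : ℝ, 0 < K ∧ ∀ z : ℂ, (∀ u ∈ Metric.ball z 3, w u ≠ 0) →
      ‖(deriv w z / w z) ^ 2 - c * z ^ 3‖ ≤ K * (3 + ‖z‖) ^ 2 := by
  set C : ℝ := 1 + ‖c‖ + ‖c₂‖ + ‖c₁‖ + ‖c₀‖ with hC
  have n3 := norm_nonneg c
  have n2 := norm_nonneg c₂
  have n1 := norm_nonneg c₁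
  have n0 := norm_nonneg c₀
  have hC1 : 1 ≤ C := by linarith
  have hlow : ∀ z : ℂ, ‖c₂ * z ^ 2 + c₁ * z + c₀‖ ≤ (C - ‖c‖) * (1 + ‖z‖) ^ 2 := by
    intro z
    have hz := norm_nonneg z
    calc ‖c₂ * z ^ 2 + c₁ * z + c₀‖ ≤ ‖c₂‖ * ‖z‖ ^ 2 + ‖c₁‖ * ‖z‖ + ‖c₀‖ := by
          refine (norm_add₃_le).trans ?_
          simp
      _ ≤ ‖c₂‖ * (1 + ‖z‖) ^ 2 + ‖c₁‖ * (1 + ‖z‖) ^ 2 + ‖c₀‖ * (1 + ‖z‖) ^ 2 := by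
          gcongr
          · linarith
          · nlinarith
          · exact le_mul_of_one_le_right n0 (by nlinarith)
      _ ≤ _ := by rw [hC]; nlinarith [sq_nonneg (1 + ‖z‖)]
  have hq : ∀ z : ℂ, ‖c * z ^ 3 + c₂ * z ^ 2 + c₁ * z + c₀‖ ≤ C * (1 + ‖z‖) ^ 3 := by
    intro z
    have hz := norm_nonneg z
    calc ‖c * z ^ 3 + c₂ * z ^ 2 + c₁ * z + c₀‖ = ‖c * z ^ 3 + (c₂ * z ^ 2 + c₁ * z + c₀)‖ := by
          congr 1; ring
      _ ≤ ‖c‖ * ‖z‖ ^ 3 + (C - ‖c‖) * (1 + ‖z‖) ^ 2 := by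
          refine (norm_add_le _ _).trans (add_le_add (by simp) (hlow z))
      _ ≤ ‖c‖ * (1 + ‖z‖) ^ 3 + (C - ‖c‖) * (1 + ‖z‖) ^ 3 := by
          have : 0 ≤ C - ‖c‖ := by linarith
          gcongr
          · linarith
          · linarith
          · norm_num
      _ = _ := by ring
  have hr : ∀ z : ℂ, (∀ u ∈ Metric.ball z 1, w u ≠ 0) →
      ‖deriv w z / w z‖ ≤ 24 * (C * (2 + ‖z‖) ^ 2) := by
    intro z h0
    have hz := norm_nonneg z
    refine norm_logDeriv_le_of_deriv_deriv_eq hw hode (by nlinarith) h0 fun u hu => ?_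
    have hu' : ‖u‖ ≤ ‖z‖ + 1 := by
      have h1 : ‖u - z‖ < 1 := by simpa [dist_eq_norm] using hu
      have := norm_le_norm_add_norm_sub' u z
      linarith
    have hu0 := norm_nonneg u
    calc _ ≤ C * (1 + ‖u‖) ^ 3 := hq u
      _ ≤ C * (2 + ‖z‖) ^ 3 := by
          gcongr C * ?_ ^ 3
          linarith
      _ ≤ C ^ 2 * (2 + ‖z‖) ^ 4 := by
          gcongr
          · nlinarith
          · linarith
          · norm_num
      _ = _ := by ring
  refine ⟨25 * C, by positivity, fun z h0 => ?_⟩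
  have hz := norm_nonneg z
  have hwz : w z ≠ 0 := h0 z (Metric.mem_ball_self (by norm_num))
  have hdw : Differentiable ℂ (deriv w) := fun z => (hode z).differentiableAt
  have hrd : HasDerivAt (fun z => deriv w z / w z)
      (c * z ^ 3 + c₂ * z ^ 2 + c₁ * z + c₀ - (deriv w z / w z) ^ 2) z := by
    refine ((hode z).div (hw z).hasDerivAt hwz).congr_deriv ?_
    field_simp
  have hcau := norm_deriv_le_of_forall_mem_sphere_norm_le (c := z) (R := 1)
    (C := 24 * (C * (3 + ‖z‖) ^ 2)) (f := fun z => deriv w z / w z) one_pos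
    (DifferentiableOn.diffContOnCl (hdw.differentiableOn.div hw.differentiableOn fun u hu => h0 u
      (Metric.closedBall_subset_ball (by norm_num) (Metric.closure_ball_subset_closedBall hu))))
    (fun u hu => ?_)
  · rw [hrd.deriv, div_one] at hcau
    have heq : (deriv w z / w z) ^ 2 - c * z ^ 3 = (c₂ * z ^ 2 + c₁ * z + c₀) -
        (c * z ^ 3 + c₂ * z ^ 2 + c₁ * z + c₀ - (deriv w z / w z) ^ 2) := by ring
    rw [heq]
    calc _ ≤ _ := norm_sub_le _ _
      _ ≤ (C - ‖c‖) * (1 + ‖z‖) ^ 2 + 24 * (C * (3 + ‖z‖) ^ 2) := add_le_add (hlow z) hcau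
      _ ≤ C * (3 + ‖z‖) ^ 2 + 24 * (C * (3 + ‖z‖) ^ 2) := by
          gcongr
          · linarith
          · norm_num
      _ = _ := by ring
  · have hu1 : ‖u - z‖ = 1 := by simpa [dist_eq_norm] using hu
    have hu' : ‖u‖ ≤ ‖z‖ + 1 := by
      have := norm_le_norm_add_norm_sub' u z
      linarith
    refine (hr u fun v hv => h0 v ?_).trans ?_
    · rw [Metric.mem_ball] at hv ⊢
      have := dist_triangle v u z
      rw [dist_eq_norm u z] at this
      linarith
    · have := norm_nonneg u
      gcongr 24 * (C * ?_ ^ 2)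
      linarith

/-- With `z = ζ²`, the logarithmic derivative `r` of a solution of `w'' = (c z³ + ⋯) w` satisfies
`(r / ζ³)² → c` away from the zeros of `w`. -/
theorem exists_forall_norm_logDeriv_div_sq_sub_le {w : ℂ → ℂ} (hw : Differentiable ℂ w)
    {c c₂ c₁ c₀ : ℂ}
    (hode : ∀ z, HasDerivAt (deriv w) ((c * z ^ 3 + c₂ * z ^ 2 + c₁ * z + c₀) * w z) z)
    {ε : ℝ} (hε : 0 < ε) :
    ∃ R : ℝ, 0 < R ∧ ∀ ζ : ℂ, R ≤ ‖ζ‖ → (∀ u ∈ Metric.ball (ζ ^ 2) 3, w u ≠ 0) →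
      ‖(deriv w (ζ ^ 2) / w (ζ ^ 2) / ζ ^ 3) ^ 2 - c‖ ≤ ε := by
  obtain ⟨K, hK, h⟩ := exists_forall_norm_logDeriv_sq_sub_le hw hode
  refine ⟨3 + 4 * K / ε, by positivity, fun ζ hζ h0 => ?_⟩
  have hKε : 0 < 4 * K / ε := by positivity
  have hζ0 : ζ ≠ 0 := by
    rw [← norm_pos_iff]; linarith
  have hT : ‖ζ‖ ≤ ‖ζ‖ ^ 2 := by nlinarith
  have hz := h (ζ ^ 2) h0
  have heq : (deriv w (ζ ^ 2) / w (ζ ^ 2) / ζ ^ 3) ^ 2 - c =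
      ((deriv w (ζ ^ 2) / w (ζ ^ 2)) ^ 2 - c * (ζ ^ 2) ^ 3) / (ζ ^ 2) ^ 3 := by
    field_simp
  rw [norm_pow] at hz
  rw [heq, norm_div, norm_pow (ζ ^ 2), norm_pow ζ, div_le_iff₀ (by positivity)]
  set T := ‖ζ‖ ^ 2
  have hT3 : 3 ≤ T := by linarith
  have hTK : 4 * K ≤ ε * T := by
    rw [← div_le_iff₀' hε]; linarith
  calc _ ≤ K * (3 + T) ^ 2 := hz
    _ ≤ K * (T + T) ^ 2 := by gcongr
    _ = 4 * K * T ^ 2 := by ring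
    _ ≤ ε * T * T ^ 2 := by gcongr
    _ = _ := by ring

/-- A nontrivial entire solution of `w'' = q w` with `q` cubic has infinitely many zeros. -/
theorem infinite_zeros_of_deriv_deriv_eq_cubic {w : ℂ → ℂ} (hw : Differentiable ℂ w)
    {c c₂ c₁ c₀ : ℂ} (hc : c ≠ 0)
    (hode : ∀ z, HasDerivAt (deriv w) ((c * z ^ 3 + c₂ * z ^ 2 + c₁ * z + c₀) * w z) z) :
    {z | w z = 0}.Infinite := by
  intro hfin
  obtain ⟨B, hB⟩ := hfin.isBounded.exists_norm_le
  obtain ⟨d, hd⟩ := IsAlgClosed.exists_pow_nat_eq c two_pos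
  have hd0 : d ≠ 0 := by rintro rfl; exact hc (by simpa using hd.symm)
  obtain ⟨R, hR, h⟩ := exists_forall_norm_logDeriv_div_sq_sub_le hw hode
    (ε := ‖c‖ / 2) (by positivity)
  set ρ : ℝ := R + |B| + 4 with hρ
  have hρ0 : 0 < ρ := by positivity
  have hfree : ∀ ζ : ℂ, ‖ζ‖ = ρ → ∀ u ∈ Metric.ball (ζ ^ 2) 3, w u ≠ 0 := by
    intro ζ hζ u hu hu0
    have h1 := hB u hu0
    have h2 : ‖u - ζ ^ 2‖ < 3 := by simpa [dist_eq_norm] using hu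
    have h3 := norm_le_norm_add_norm_sub u (ζ ^ 2)
    rw [norm_pow, hζ] at h3
    have := le_abs_self B
    have := abs_nonneg B
    nlinarith
  have hre : ∀ ζ : ℂ, ‖ζ‖ = ρ → (deriv w (ζ ^ 2) / w (ζ ^ 2) / ζ ^ 3 / d).re ≠ 0 := by
    intro ζ hζ h0
    have h1 := h ζ (by rw [hζ, hρ]; linarith [abs_nonneg B]) (hfree ζ hζ)
    set F := deriv w (ζ ^ 2) / w (ζ ^ 2) / ζ ^ 3
    have h2 : F ^ 2 - c = ((F / d) ^ 2 - 1) * c := by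
      rw [← hd]; field_simp
    have hcpos : 0 < ‖c‖ := norm_pos_iff.2 hc
    rw [h2, norm_mul] at h1
    have h3 : ‖(F / d) ^ 2 - 1‖ ≤ 1 / 2 := by
      nlinarith
    have h4 := (Complex.abs_re_le_norm _).trans h3
    have h5 : ((F / d) ^ 2 - 1).re = -(F / d).im ^ 2 - 1 := by
      simp [sq, h0]
    rw [h5, abs_le] at h4
    nlinarith [sq_nonneg (F / d).im]
  set γ : ℝ → ℂ := fun t => circleMap 0 ρ t
  have hγn : ∀ t, ‖γ t‖ = ρ := fun t => by simp [γ, abs_of_pos hρ0]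
  set G : ℝ → ℝ := fun t => (deriv w (γ t ^ 2) / w (γ t ^ 2) / γ t ^ 3 / d).re with hG
  have hdw : Differentiable ℂ (deriv w) := fun z => (hode z).differentiableAt
  have hGc : Continuous G := by
    have hγc : Continuous γ := continuous_circleMap 0 ρ
    refine continuous_re.comp (((hdw.continuous.comp (hγc.pow 2)).div
      (hw.continuous.comp (hγc.pow 2)) fun t => ?_).div (hγc.pow 3) (fun t => ?_) |>.div_const d)
    · exact hfree _ (hγn t) _ (Metric.mem_ball_self (by norm_num))
    · exact pow_ne_zero _ (norm_pos_iff.1 (by rw [hγn]; exact hρ0))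
  have hodd : G Real.pi = -G 0 := by
    have : γ Real.pi = -γ 0 := by simp [γ, circleMap]
    simp only [hG, this]
    rw [neg_sq, Odd.neg_pow (by decide), div_neg, neg_div, neg_re]
  have hzero : ∃ t, G t = 0 := by
    rcases le_total (G 0) 0 with h0 | h0
    · exact mem_range_of_exists_le_of_exists_ge hGc ⟨0, h0⟩ ⟨Real.pi, by linarith⟩
    · exact mem_range_of_exists_le_of_exists_ge hGc ⟨Real.pi, by linarith⟩ ⟨0, h0⟩
  obtain ⟨t, ht⟩ := hzero
  exact hre _ (hγn t) ht

open ComplexConjugate in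
/-- Green's identity for `w'' = q w` along a line with direction `u`. -/
theorem hasDerivAt_im_deriv_mul_conj {w q : ℂ → ℂ} (hw : Differentiable ℂ w)
    (hode : ∀ z, HasDerivAt (deriv w) (q z * w z) z) (z₀ u : ℂ) (t : ℝ) :
    HasDerivAt (fun t : ℝ => (deriv w (z₀ + t * u) * conj (w (z₀ + t * u))).im)
      ((u * q (z₀ + t * u)).im * normSq (w (z₀ + t * u)) -
        u.im * normSq (deriv w (z₀ + t * u))) t := by
  have hline : HasDerivAt (fun t : ℝ => z₀ + (t : ℂ) * u) u t := by
    simpa using ((hasDerivAt_id t).ofReal_comp.mul_const u).const_add z₀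
  have h1 := (hode (z₀ + t * u)).comp t hline
  have h2 := ((hw (z₀ + t * u)).hasDerivAt.comp t hline).star
  have h3 := imCLM.hasFDerivAt.comp_hasDerivAt t (h1.mul h2)
  refine h3.congr_deriv ?_
  simp only [Function.comp_apply, imCLM_apply, normSq_apply, star_def, mul_im, mul_re, add_im,
    conj_re, conj_im]
  ring

/-- If a nontrivial entire solution of `w'' = q w` has infinitely many real zeros, then a real
polynomial agreeing with `Im q` on the real line vanishes. -/
theorem eq_zero_of_infinite_real_zeros {w q : ℂ → ℂ} (hw : Differentiable ℂ w) (hw0 : w ≠ 0)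
    (hode : ∀ z, HasDerivAt (deriv w) (q z * w z) z) {B : Polynomial ℝ}
    (hB : ∀ x : ℝ, (q x).im = B.eval x) (hinf : {x : ℝ | w x = 0}.Infinite) : B = 0 := by
  by_contra hB0
  obtain ⟨x, hx, y, hy, hxy, hroots⟩ := hinf.exists_ne_map_eq_of_mapsTo
    (f := fun x => B.roots.toFinset.filter (· < x)) (t := B.roots.toFinset.powerset)
    (fun x _ => Finset.mem_coe.2 (Finset.mem_powerset.2 (Finset.filter_subset _ _)))
    (Finset.finite_toSet _)
  wlog hlt : x < y generalizing x y
  · exact this y hy x hx hxy.symm hroots.symm (lt_of_le_of_ne (not_lt.1 hlt) hxy.symm)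
  have hne : ∀ s ∈ Set.Ioo x y, B.eval s ≠ 0 := by
    intro s hs h0
    have h1 : s ∈ B.roots.toFinset.filter (· < y) := by
      simp [hB0, h0, hs.2]
    have h2 : s ∈ B.roots.toFinset.filter (· < x) := by
      have : B.roots.toFinset.filter (· < x) = B.roots.toFinset.filter (· < y) := hroots
      rw [this]; exact h1
    exact absurd (Finset.mem_filter.1 h2).2 (not_lt.2 hs.1.le)
  set φ : ℝ → ℝ := fun t => (deriv w t * (starRingEnd ℂ) (w t)).im with hφ
  have hφd : ∀ t : ℝ, HasDerivAt φ (B.eval t * normSq (w t)) t := by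
    intro t
    simpa [hφ, hB] using hasDerivAt_im_deriv_mul_conj hw hode 0 1 t
  have hx0 : w x = 0 := hx
  have hy0 : w y = 0 := hy
  have hend : φ x = φ y := by simp [hφ, hx0, hy0]
  have hsign : (∀ s ∈ Set.Ioo x y, 0 < B.eval s) ∨ (∀ s ∈ Set.Ioo x y, B.eval s < 0) := by
    by_contra! hcon
    obtain ⟨⟨s, hs, hs0⟩, r, hr, hr0⟩ := hcon
    obtain ⟨p, hp, hp0⟩ := isPreconnected_Ioo.intermediate_value hs hr
      B.continuous.continuousOn ⟨hs0, hr0⟩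
    exact hne p hp hp0
  have hcont : ContinuousOn φ (Set.Icc x y) := fun t _ => (hφd t).continuousAt.continuousWithinAt
  have hconst : ∀ s ∈ Set.Icc x y, φ s = φ x := by
    intro s hs
    rcases hsign with h | h
    · have hm := monotoneOn_of_deriv_nonneg (convex_Icc x y) hcont
        (fun t _ => (hφd t).differentiableAt.differentiableWithinAt) (fun t ht => by
          rw [(hφd t).deriv]
          rw [interior_Icc] at ht
          exact mul_nonneg (h t ht).le (normSq_nonneg _))
      have h1 := hm (Set.left_mem_Icc.2 hlt.le) hs hs.1
      have h2 := hm hs (Set.right_mem_Icc.2 hlt.le) hs.2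
      linarith
    · have hm := antitoneOn_of_deriv_nonpos (convex_Icc x y) hcont
        (fun t _ => (hφd t).differentiableAt.differentiableWithinAt) (fun t ht => by
          rw [(hφd t).deriv]
          rw [interior_Icc] at ht
          exact mul_nonpos_of_nonpos_of_nonneg (h t ht).le (normSq_nonneg _))
      have h1 := hm (Set.left_mem_Icc.2 hlt.le) hs hs.1
      have h2 := hm hs (Set.right_mem_Icc.2 hlt.le) hs.2
      linarith
  have hzero : ∀ s ∈ Set.Ioo x y, w s = 0 := by
    intro s hs
    have hev : φ =ᶠ[nhds s] fun _ => φ x := by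
      filter_upwards [Icc_mem_nhds hs.1 hs.2] with t ht using hconst t ht
    have h1 := hev.deriv_eq
    rw [(hφd s).deriv, deriv_const] at h1
    exact normSq_eq_zero.1 ((mul_eq_zero.1 h1).resolve_left (hne s hs))
  obtain ⟨m, hm⟩ := exists_between hlt
  have hfreq : ∃ᶠ z in nhdsWithin (m : ℂ) {(m : ℂ)}ᶜ, w z = 0 := by
    have h1 : Tendsto (fun t : ℝ => (t : ℂ)) (nhdsWithin m {m}ᶜ)
        (nhdsWithin (m : ℂ) {(m : ℂ)}ᶜ) := by
      refine tendsto_nhdsWithin_iff.2 ⟨(continuous_ofReal.tendsto m).mono_left nhdsWithin_le_nhds, ?_⟩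
      filter_upwards [self_mem_nhdsWithin] with t ht
      simpa using ht
    refine h1.frequently (Eventually.frequently ?_)
    filter_upwards [nhdsWithin_le_nhds (Ioo_mem_nhds hm.1 hm.2)] with t ht using hzero t ht
  have hana : AnalyticOnNhd ℂ w Set.univ := fun z _ => hw.analyticAt z
  apply hw0
  funext z
  exact hana.eqOn_zero_of_preconnected_of_frequently_eq_zero isPreconnected_univ (Set.mem_univ _)
    hfreq (Set.mem_univ z)

/-- A complex number whose square is within `1 / 8` of `1` is close to the real axis and away from
the imaginary axis. -/
theorem sq_re_and_abs_im_of_norm_sq_sub_one_le {s : ℂ} (hs : ‖s ^ 2 - 1‖ ≤ 1 / 8) :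
    7 / 8 ≤ s.re ^ 2 ∧ |s.im| ≤ 1 / 10 := by
  have h1 := (abs_re_le_norm _).trans hs
  have h2 := (abs_im_le_norm _).trans hs
  have e1 : (s ^ 2 - 1).re = s.re ^ 2 - s.im ^ 2 - 1 := by simp [sq]
  have e2 : (s ^ 2 - 1).im = 2 * (s.re * s.im) := by simp [sq]; ring
  rw [e1, abs_le] at h1
  rw [e2, abs_le] at h2
  have hre : 7 / 8 ≤ s.re ^ 2 := by nlinarith [sq_nonneg s.im]
  refine ⟨hre, ?_⟩
  rw [← Real.sqrt_sq_eq_abs, Real.sqrt_le_left (by norm_num)]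
  have h3 : (s.re * s.im) ^ 2 ≤ (1 / 16) ^ 2 := by
    rw [sq_le_sq, abs_le]; norm_num; constructor <;> linarith
  nlinarith [sq_nonneg s.im]

/-- A solution of `w'' = (z³ - a z + λ) w` with a real zero satisfies `Im (w' w̄) ≤ 0` on vertical
segments which start on the real axis and along which the real part of the potential is
nonpositive. -/
theorem im_deriv_mul_conj_nonpos {w : ℂ → ℂ} (hw : Differentiable ℂ w) {a lam : ℝ}
    (hode : ∀ z, HasDerivAt (deriv w) ((z ^ 3 - (a : ℂ) * z + (lam : ℂ)) * w z) z)
    {x₀ : ℝ} (hx₀ : w x₀ = 0) {x y : ℝ} (hy : 0 ≤ y)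
    (hs : ∀ s ∈ Set.Icc 0 y, x ^ 3 - 3 * x * s ^ 2 - a * x + lam ≤ 0) :
    (deriv w (x + y * I) * (starRingEnd ℂ) (w (x + y * I))).im ≤ 0 := by
  have hreal : ∀ x : ℝ, (deriv w x * (starRingEnd ℂ) (w x)).im = 0 := by
    have hd : ∀ x : ℝ, HasDerivAt (fun x : ℝ => (deriv w x * (starRingEnd ℂ) (w x)).im) 0 x := by
      intro x
      have := hasDerivAt_im_deriv_mul_conj hw hode 0 1 x
      have h0 : ((x : ℂ) ^ 3 - (a : ℂ) * x + (lam : ℂ)).im = 0 := by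
        rw [show (x : ℂ) ^ 3 - (a : ℂ) * x + (lam : ℂ) = ((x ^ 3 - a * x + lam : ℝ) : ℂ) by
          push_cast; ring]
        exact ofReal_im _
      simpa [h0] using this
    intro x
    have := is_const_of_deriv_eq_zero (fun x => (hd x).differentiableAt) (fun x => (hd x).deriv)
      x x₀
    simpa [hx₀] using this
  have hd := hasDerivAt_im_deriv_mul_conj hw hode x I
  have hm := antitoneOn_of_deriv_nonpos (convex_Icc 0 y)
    (fun t _ => (hd t).continuousAt.continuousWithinAt)
    (fun t _ => (hd t).differentiableAt.differentiableWithinAt) (fun t ht => by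
      rw [(hd t).deriv]
      have h1 := hs t (interior_subset ht)
      have h2 : (I * (((x : ℂ) + t * I) ^ 3 - (a : ℂ) * (x + t * I) + (lam : ℂ))).im =
          x ^ 3 - 3 * x * t ^ 2 - a * x + lam := by
        simp [pow_succ]; ring
      rw [h2, I_im, one_mul]
      have h3 := normSq_nonneg (deriv w (x + t * I))
      have h4 := mul_nonpos_of_nonpos_of_nonneg h1 (normSq_nonneg (w (x + t * I)))
      linarith)
  have h := hm (Set.left_mem_Icc.2 hy) (Set.right_mem_Icc.2 hy) hy
  have h0 := hreal x
  simp only [ofReal_zero, zero_mul, add_zero] at h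
  linarith

/-- If the flux `Im (w' w̄)` dominates `|w|²` far up the imaginary axis, then `w` decays there. -/
theorem tendsto_zero_of_normSq_le_im {w : ℂ → ℂ} (hw : Differentiable ℂ w) {T : ℝ}
    (h : ∀ t : ℝ, T ≤ t →
      normSq (w (t * I)) ≤ (deriv w (t * I) * (starRingEnd ℂ) (w (t * I))).im) :
    Tendsto (fun t : ℝ => w ((t : ℂ) * I)) atTop (nhds 0) := by
  have hNd : ∀ t : ℝ, HasDerivAt (fun t : ℝ => Real.exp (2 * t) * normSq (w (t * I)))
      (2 * Real.exp (2 * t) * (normSq (w (t * I)) -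
        (deriv w (t * I) * (starRingEnd ℂ) (w (t * I))).im)) t := by
    intro t
    have hline : HasDerivAt (fun t : ℝ => (t : ℂ) * I) I t := by
      simpa using (hasDerivAt_id t).ofReal_comp.mul_const I
    have h1 := (hw (t * I)).hasDerivAt.comp t hline
    have h2 := reCLM.hasFDerivAt.comp_hasDerivAt t h1
    have h3 := imCLM.hasFDerivAt.comp_hasDerivAt t h1
    have h4 : HasDerivAt (fun t : ℝ => Real.exp (2 * t)) (Real.exp (2 * t) * 2) t := by
      simpa using ((hasDerivAt_id t).const_mul 2).exp
    have h5 := h4.mul ((h2.mul h2).add (h3.mul h3))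
    refine (h5.congr_deriv ?_).congr_of_eventuallyEq (Eventually.of_forall fun t => ?_)
    · simp [normSq_apply]
      ring
    · simp [normSq_apply]
  have hanti := antitoneOn_of_deriv_nonpos (convex_Ici T)
    (fun t _ => (hNd t).continuousAt.continuousWithinAt)
    (fun t _ => (hNd t).differentiableAt.differentiableWithinAt) (fun t ht => by
      rw [(hNd t).deriv]
      have := h t (interior_subset ht)
      exact mul_nonpos_of_nonneg_of_nonpos (by positivity) (by linarith))
  set N₀ := Real.exp (2 * T) * normSq (w ((T : ℂ) * I)) with hN₀
  have hbound : ∀ᶠ t : ℝ in atTop, normSq (w (t * I)) ≤ N₀ * Real.exp (-(2 * t)) := by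
    filter_upwards [eventually_ge_atTop T] with t ht
    have h1 := hanti (Set.self_mem_Ici) ht ht
    rw [Real.exp_neg, ← div_eq_mul_inv, le_div_iff₀ (Real.exp_pos _), mul_comm]
    exact h1
  have hlim : Tendsto (fun t : ℝ => N₀ * Real.exp (-(2 * t))) atTop (nhds 0) := by
    have := (Real.tendsto_exp_neg_atTop_nhds_zero.comp
      (tendsto_id.const_mul_atTop (two_pos : (0 : ℝ) < 2))).const_mul N₀
    simpa using this
  have hsqz := squeeze_zero' (Eventually.of_forall fun t => normSq_nonneg _) hbound hlim
  rw [tendsto_zero_iff_norm_tendsto_zero]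
  have := hsqz.sqrt
  simpa [← norm_def, Complex.norm_def] using this

/-- The real part of `z³ - a z + λ` is nonpositive on the vertical segment from the real axis to
`(1 + b i)²` when `b` is large. -/
theorem cubic_nonpos_of_large {a lam b t : ℝ} (hb : 10 + |a| + |lam| ≤ b)
    (ht : t ∈ Set.Icc 0 (2 * b)) :
    (1 - b ^ 2) ^ 3 - 3 * (1 - b ^ 2) * t ^ 2 - a * (1 - b ^ 2) + lam ≤ 0 := by
  have han := abs_nonneg a
  have hln := abs_nonneg lam
  have hb10 : 10 ≤ b := by linarith
  have hbb : 10 * b ≤ b ^ 2 := by nlinarith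
  have hX : 1 ≤ b ^ 2 - 1 := by linarith
  have ht2 : t ^ 2 ≤ 4 * b ^ 2 := by
    have := pow_le_pow_left₀ ht.1 ht.2 2
    linarith [this, mul_pow 2 b 2]
  have h5 : 98 * b ^ 2 ≤ (b ^ 2 - 1) ^ 2 := by
    have : 0 ≤ b ^ 2 * (b ^ 2 - 100) := mul_nonneg (sq_nonneg b) (by linarith)
    linarith [this, show (b ^ 2 - 1) ^ 2 = b ^ 2 * (b ^ 2 - 100) + 98 * b ^ 2 + 1 by ring]
  have h7 : (b ^ 2 - 1) * (3 * t ^ 2 + a + |lam|) ≤ (b ^ 2 - 1) * (b ^ 2 - 1) ^ 2 := by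
    apply mul_le_mul_of_nonneg_left _ (by linarith)
    linarith [le_abs_self a]
  have h8 : |lam| ≤ (b ^ 2 - 1) * |lam| := le_mul_of_one_le_left hln hX
  linarith [le_abs_self lam, show (1 - b ^ 2) ^ 3 - 3 * (1 - b ^ 2) * t ^ 2 - a * (1 - b ^ 2) + lam =
    (b ^ 2 - 1) * (3 * t ^ 2 + a + |lam|) - (b ^ 2 - 1) * (b ^ 2 - 1) ^ 2
      - (b ^ 2 - 1) * |lam| + lam by ring]

/-- If `p + r i` is close to `-1`, then the imaginary part of `(p + r i) (1 + b i)³` is positive for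
large `b`. -/
theorem im_mul_cube_pos {p r b : ℝ} (hb : 10 ≤ b) (hp : 7 / 8 ≤ p ^ 2) (hr : |r| ≤ 1 / 10)
    (hneg : p ≤ 0) : 0 < p * (3 * b - b ^ 3) + r * (1 - 3 * b ^ 2) := by
  have hp : p ≤ -(9 / 10) := by nlinarith
  rw [abs_le] at hr
  have hb2 : 10 * b ≤ b ^ 2 := by nlinarith
  have hb3 : 10 * b ^ 2 ≤ b ^ 3 := by
    have := mul_le_mul_of_nonneg_right hb (sq_nonneg b)
    linarith [this, show b * b ^ 2 = b ^ 3 by ring]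
  have h6 : 9 / 10 * (b ^ 3 - 3 * b) ≤ (-p) * (b ^ 3 - 3 * b) :=
    mul_le_mul_of_nonneg_right (by linarith) (by linarith)
  have h7 : r * (3 * b ^ 2 - 1) ≤ 1 / 10 * (3 * b ^ 2 - 1) :=
    mul_le_mul_of_nonneg_right hr.2 (by linarith)
  linarith

/-- A solution of `w'' = (z³ - a z + λ) w` with a real zero and finitely many nonreal zeros decays
along the positive imaginary axis. -/
theorem tendsto_zero_imaginary_axis {w : ℂ → ℂ} (hw : Differentiable ℂ w) {a lam : ℝ}
    (hode : ∀ z, HasDerivAt (deriv w) ((z ^ 3 - (a : ℂ) * z + (lam : ℂ)) * w z) z)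
    {x₀ : ℝ} (hx₀ : w x₀ = 0) (hfin : {z : ℂ | w z = 0 ∧ z.im ≠ 0}.Finite) :
    Tendsto (fun t : ℝ => w ((t : ℂ) * I)) atTop (nhds 0) := by
  have hdw : Differentiable ℂ (deriv w) := fun z => (hode z).differentiableAt
  obtain ⟨B, hB⟩ := hfin.isBounded.exists_norm_le
  obtain ⟨R, hR, hs⟩ := exists_forall_norm_logDeriv_div_sq_sub_le hw (c := 1) (c₂ := 0)
    (c₁ := -a) (c₀ := lam) (fun z => (hode z).congr_deriv (by ring))
    (ε := 1 / 8) (by norm_num)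
  set b : ℝ := R + |B| + |a| + |lam| + 10 with hb
  have hBn := abs_nonneg B
  have han := abs_nonneg a
  have hln := abs_nonneg lam
  set Ω : Set ℂ := {ζ | 1 ≤ ζ.re ∧ b ≤ ζ.im} with hΩ
  have hΩc : Convex ℝ Ω := (convex_halfSpace_re_ge 1).inter (convex_halfSpace_im_ge b)
  have hfree : ∀ ζ ∈ Ω, ∀ u ∈ Metric.ball (ζ ^ 2) 3, w u ≠ 0 := by
    intro ζ hζ u hu hu0
    have h1 : ‖u - ζ ^ 2‖ < 3 := by simpa [dist_eq_norm] using hu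
    have h2 := (abs_le.1 ((abs_im_le_norm (u - ζ ^ 2)).trans h1.le)).1
    have h3 : (u - ζ ^ 2).im = u.im - 2 * (ζ.re * ζ.im) := by simp [sq]; ring
    have h4 : b ≤ ζ.re * ζ.im := by
      have := hζ.2
      nlinarith [hζ.1]
    have h5 : |B| < u.im := by linarith
    have h6 := hB u ⟨hu0, by linarith⟩
    have := (le_abs_self _).trans (abs_im_le_norm u)
    linarith [le_abs_self B]
  set s : ℂ → ℂ := fun ζ => deriv w (ζ ^ 2) / w (ζ ^ 2) / ζ ^ 3 with hs_def
  have hwne : ∀ ζ ∈ Ω, w (ζ ^ 2) ≠ 0 := fun ζ hζ =>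
    hfree ζ hζ _ (Metric.mem_ball_self (by norm_num))
  have hζne : ∀ ζ ∈ Ω, ζ ≠ 0 := by
    rintro ζ hζ rfl
    have := hζ.1
    norm_num at this
  have hsb : ∀ ζ ∈ Ω, 7 / 8 ≤ (s ζ).re ^ 2 ∧ |(s ζ).im| ≤ 1 / 10 := by
    intro ζ hζ
    refine sq_re_and_abs_im_of_norm_sq_sub_one_le (hs ζ ?_ (hfree ζ hζ))
    have := (le_abs_self _).trans (abs_im_le_norm ζ)
    linarith [hζ.2]
  have hsc : ContinuousOn (fun ζ => (s ζ).re) Ω := by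
    refine continuous_re.comp_continuousOn (ContinuousOn.div (ContinuousOn.div ?_ ?_ hwne) ?_ ?_)
    · exact (hdw.continuous.comp (continuous_pow 2)).continuousOn
    · exact (hw.continuous.comp (continuous_pow 2)).continuousOn
    · exact (continuous_pow 3).continuousOn
    · exact fun ζ hζ => pow_ne_zero _ (hζne ζ hζ)
  have hlog : ∀ ζ ∈ Ω, deriv w (ζ ^ 2) * (starRingEnd ℂ) (w (ζ ^ 2)) =
      (normSq (w (ζ ^ 2)) : ℂ) * (s ζ * ζ ^ 3) := by
    intro ζ hζ
    have h1 := hwne ζ hζ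
    have h2 := hζne ζ hζ
    rw [← mul_conj]
    simp only [hs_def]
    field_simp
  have hb10 : 10 ≤ b := by linarith
  have hpos₁ : 0 < (s (1 + b * I)).re := by
    have hmem : (1 + b * I : ℂ) ∈ Ω := by simp [hΩ]
    obtain ⟨h1, h2⟩ := hsb _ hmem
    by_contra! hneg
    have hsq : ((1 : ℂ) + b * I) ^ 2 = ((1 - b ^ 2 : ℝ) : ℂ) + ((2 * b : ℝ) : ℂ) * I := by
      push_cast
      ring_nf
      simp [I_sq]
      ring
    have h3 := im_deriv_mul_conj_nonpos hw hode hx₀ (x := 1 - b ^ 2) (y := 2 * b)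
      (by linarith) (fun t ht => cubic_nonpos_of_large (by linarith) ht)
    rw [← hsq, hlog _ hmem, im_ofReal_mul] at h3
    have hN : 0 < normSq (w ((1 + b * I) ^ 2)) := normSq_pos.2 (hwne _ hmem)
    have h4 : (s (1 + b * I) * (1 + b * I) ^ 3).im ≤ 0 := by
      by_contra! hc
      exact absurd h3 (not_le.2 (mul_pos hN hc))
    have h5 : (s (1 + b * I) * (1 + b * I) ^ 3).im =
        (s (1 + b * I)).re * (3 * b - b ^ 3) + (s (1 + b * I)).im * (1 - 3 * b ^ 2) := by
      simp [pow_succ]; ring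
    rw [h5] at h4
    exact absurd h4 (not_le.2 (im_mul_cube_pos hb10 h1 h2 hneg))
  have hpos : ∀ ζ ∈ Ω, 0 < (s ζ).re := by
    intro ζ hζ
    by_contra! hneg
    obtain ⟨p, hp, hp0⟩ := hΩc.isPreconnected.intermediate_value hζ
      (show (1 + b * I : ℂ) ∈ Ω by simp [hΩ]) hsc ⟨hneg, hpos₁.le⟩
    have := (hsb p hp).1
    simp only at hp0
    rw [hp0] at this
    norm_num at this
  refine tendsto_zero_of_normSq_le_im hw (T := 2 * b ^ 2) ?_
  have hflux : ∀ t : ℝ, 2 * b ^ 2 ≤ t →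
      normSq (w (t * I)) ≤ (deriv w (t * I) * (starRingEnd ℂ) (w (t * I))).im := by
    intro t ht
    set τ := Real.sqrt (t / 2) with hτ
    have hτ2 : τ ^ 2 = t / 2 := Real.sq_sqrt (by nlinarith)
    have hτb : b ≤ τ := Real.le_sqrt_of_sq_le (by linarith)
    have hmem : (τ + τ * I : ℂ) ∈ Ω := by
      refine ⟨?_, ?_⟩ <;> simp <;> linarith
    have hsq : ((τ : ℂ) + τ * I) ^ 2 = t * I := by
      have : (t : ℂ) = 2 * (τ : ℂ) ^ 2 := by
        rw [← ofReal_pow, hτ2]; push_cast; ring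
      rw [this]
      ring_nf
      simp [I_sq]
    have h1 := hlog _ hmem
    obtain ⟨h2, h3⟩ := hsb _ hmem
    have h4 := hpos _ hmem
    rw [hsq] at h1
    rw [h1, im_ofReal_mul]
    apply le_mul_of_one_le_right (normSq_nonneg _)
    have h5 : (s (τ + τ * I) * (τ + τ * I) ^ 3).im =
        2 * τ ^ 3 * ((s (τ + τ * I)).re - (s (τ + τ * I)).im) := by
      simp [pow_succ]; ring
    rw [h5]
    set p := (s (τ + τ * I)).re
    set r := (s (τ + τ * I)).im
    have hp : 9 / 10 ≤ p := by nlinarith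
    rw [abs_le] at h3
    have hτ1 : 1 ≤ τ ^ 3 := one_le_pow₀ (by linarith)
    nlinarith
  exact hflux

/-- A solution of `w'' = (z³ - a z + λ) w` with a real zero and finitely many nonreal zeros decays
along the negative imaginary axis. -/
theorem tendsto_zero_imaginary_axis_atBot {w : ℂ → ℂ} (hw : Differentiable ℂ w) {a lam : ℝ}
    (hode : ∀ z, HasDerivAt (deriv w) ((z ^ 3 - (a : ℂ) * z + (lam : ℂ)) * w z) z)
    {x₀ : ℝ} (hx₀ : w x₀ = 0) (hfin : {z : ℂ | w z = 0 ∧ z.im ≠ 0}.Finite) :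
    Tendsto (fun t : ℝ => w ((t : ℂ) * I)) atBot (nhds 0) := by
  set v : ℂ → ℂ := starRingEnd ℂ ∘ w ∘ starRingEnd ℂ with hv
  have hvd : Differentiable ℂ v := fun z => differentiableAt_conj_conj_iff.2 (hw _)
  have hvode : ∀ z, HasDerivAt (deriv v) ((z ^ 3 - (a : ℂ) * z + (lam : ℂ)) * v z) z := by
    intro z
    rw [hv, deriv_conj_conj, hasDerivAt_conj_conj_iff]
    refine (hode _).congr_deriv ?_
    simp
  have hvfin : {z : ℂ | v z = 0 ∧ z.im ≠ 0}.Finite := by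
    refine (hfin.preimage (f := starRingEnd ℂ)
      (star_injective : Function.Injective (starRingEnd ℂ)).injOn).subset ?_
    rintro z ⟨h1, h2⟩
    exact ⟨by simpa [hv] using h1, by simpa using h2⟩
  have h := tendsto_zero_imaginary_axis hvd hvode (x₀ := x₀) (by simp [hv, hx₀]) hvfin
  have h2 := (continuous_conj.tendsto 0).comp (h.comp tendsto_neg_atBot_atTop)
  simpa [hv, Function.comp_def] using h2

/-- A function with infinitely many zeros, only finitely many of them nonreal, has infinitely many
real zeros. -/
theorem infinite_real_zeros {w : ℂ → ℂ} (h : {z | w z = 0}.Infinite)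
    (hfin : {z : ℂ | w z = 0 ∧ z.im ≠ 0}.Finite) : {x : ℝ | w x = 0}.Infinite := by
  intro hreal
  refine h ((hfin.union (hreal.image ((↑) : ℝ → ℂ))).subset fun z hz => ?_)
  by_cases him : z.im = 0
  · have hre : (z.re : ℂ) = z := Complex.ext rfl (by simp [him])
    exact Or.inr ⟨z.re, by rwa [Set.mem_ofPred_eq, hre], hre⟩
  · exact Or.inl ⟨hz, him⟩

/-- The potential of `w'' = q w`, with `q` cubic, is real if the nontrivial entire solution `w` has
infinitely many real zeros. -/
theorem im_coeff_eq_zero_of_infinite_real_zeros {w : ℂ → ℂ} (hw : Differentiable ℂ w)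
    (hw0 : w ≠ 0) {c c₂ c₁ c₀ : ℂ}
    (hode : ∀ z, HasDerivAt (deriv w) ((c * z ^ 3 + c₂ * z ^ 2 + c₁ * z + c₀) * w z) z)
    (hinf : {x : ℝ | w x = 0}.Infinite) : c.im = 0 ∧ c₂.im = 0 ∧ c₁.im = 0 ∧ c₀.im = 0 := by
  have hB := eq_zero_of_infinite_real_zeros hw hw0 hode
    (B := Cubic.toPoly ⟨c.im, c₂.im, c₁.im, c₀.im⟩) (fun x => by
      simp [Cubic.toPoly, ← ofReal_pow]) hinf
  rw [Cubic.toPoly_eq_zero_iff] at hB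
  exact Cubic.ext_iff.1 hB

/-- Every cubic equation `w'' + P w = 0` possessing a solution with exactly `2n` non-real
zeros is brought, by a real affine change of the independent variable, to the PT-symmetric
normal form `W'' = (z³ − a z + λ) W`, the transformed solution being an eigenfunction of
the PT-cubic problem with exactly `2n` non-real zeros and infinitely many real zeros. -/
theorem cubic_hellerstein_rossi
    (P : Polynomial ℂ) (hdeg : P.degree = 3)
    (w : ℂ → ℂ) (hw0 : w ≠ 0) (hw : Differentiable ℂ w)
    (hode : ∀ z : ℂ, deriv (deriv w) z + P.eval z * w z = 0)
    (n : ℕ)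
    (hfin : {z : ℂ | w z = 0 ∧ z.im ≠ 0}.Finite)
    (hcard : {z : ℂ | w z = 0 ∧ z.im ≠ 0}.ncard = 2 * n) :
    ∃ (α β : ℝ) (a lam : ℝ), α ≠ 0 ∧
      (∀ z : ℂ, (α : ℂ) ^ 2 * P.eval ((α : ℂ) * z + (β : ℂ)) =
        -(z ^ 3 - (a : ℂ) * z + (lam : ℂ))) ∧
      PTCubicEigenfunction a lam (fun z => w ((α : ℂ) * z + (β : ℂ))) ∧
      {z : ℂ | w ((α : ℂ) * z + (β : ℂ)) = 0 ∧ z.im ≠ 0}.Finite ∧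
      {z : ℂ | w ((α : ℂ) * z + (β : ℂ)) = 0 ∧ z.im ≠ 0}.ncard = 2 * n ∧
      {x : ℝ | w ((α : ℂ) * (x : ℂ) + (β : ℂ)) = 0}.Infinite := by
  have hnat : P.natDegree = 3 := Polynomial.natDegree_eq_of_degree_eq_some hdeg
  have hlead : -P.coeff 3 ≠ 0 := by
    rw [neg_ne_zero, ← hnat]
    exact Polynomial.leadingCoeff_ne_zero.2 (by rintro rfl; simp at hdeg)
  have heval : ∀ z, P.eval z =
      -(-P.coeff 3 * z ^ 3 + -P.coeff 2 * z ^ 2 + -P.coeff 1 * z + -P.coeff 0) := by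
    intro z
    rw [Polynomial.eval_eq_sum_range, hnat]
    simp [Finset.sum_range_succ]
    ring
  have hdw : Differentiable ℂ (deriv w) := (hw.contDiff (n := 2)).differentiable_deriv_two
  have hode' : ∀ z, HasDerivAt (deriv w)
      ((-P.coeff 3 * z ^ 3 + -P.coeff 2 * z ^ 2 + -P.coeff 1 * z + -P.coeff 0) * w z) z := by
    intro z
    refine (hdw z).hasDerivAt.congr_deriv ?_
    rw [eq_neg_of_add_eq_zero_left (hode z), heval]
    ring
  have hinf := infinite_real_zeros (infinite_zeros_of_deriv_deriv_eq_cubic hw hlead hode') hfin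
  obtain ⟨him₃, him₂, him₁, him₀⟩ := im_coeff_eq_zero_of_infinite_real_zeros hw hw0 hode' hinf
  have hlift : ∀ {c : ℂ}, c.im = 0 → ∃ r : ℝ, c = r := fun {c} h =>
    ⟨c.re, Complex.ext rfl (by simp [h])⟩
  obtain ⟨γ₃, h₃⟩ := hlift him₃
  obtain ⟨γ₂, h₂⟩ := hlift him₂
  obtain ⟨γ₁, h₁⟩ := hlift him₁
  obtain ⟨γ₀, h₀⟩ := hlift him₀
  rw [h₃, h₂, h₁, h₀] at heval
  have hγ : γ₃ ≠ 0 := by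
    rintro rfl
    exact hlead (by simpa using h₃)
  obtain ⟨α, hα⟩ : ∃ α : ℝ, α ^ 5 = γ₃⁻¹ := by
    rcases le_total 0 γ₃⁻¹ with h | h
    · exact ⟨_, Real.rpow_inv_natCast_pow h (n := 5) (by norm_num)⟩
    · refine ⟨-(-γ₃⁻¹) ^ (((5 : ℕ) : ℝ)⁻¹), ?_⟩
      rw [Odd.neg_pow (by decide), Real.rpow_inv_natCast_pow (by linarith) (by norm_num), neg_neg]
  have hα0 : α ≠ 0 := by
    rintro rfl
    exact inv_ne_zero hγ (by simpa using hα.symm)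
  have hαγ : γ₃ * α ^ 5 = 1 := by rw [hα, mul_inv_cancel₀ hγ]
  set β : ℝ := -γ₂ / (3 * γ₃) with hβ
  have hβγ : 3 * γ₃ * β = -γ₂ := by rw [hβ]; field_simp
  set a : ℝ := -(α ^ 3 * (3 * γ₃ * β ^ 2 + 2 * γ₂ * β + γ₁)) with ha
  set lam : ℝ := α ^ 2 * (γ₃ * β ^ 3 + γ₂ * β ^ 2 + γ₁ * β + γ₀) with hlam
  have hnormal : ∀ z : ℂ, (α : ℂ) ^ 2 * P.eval ((α : ℂ) * z + (β : ℂ)) =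
      -(z ^ 3 - (a : ℂ) * z + (lam : ℂ)) := by
    intro z
    have e1 : (γ₃ : ℂ) * (α : ℂ) ^ 5 = 1 := by exact_mod_cast hαγ
    have e2 : 3 * (γ₃ : ℂ) * β = -γ₂ := by exact_mod_cast hβγ
    rw [heval, ha, hlam]
    push_cast
    linear_combination (-z ^ 3) * e1 - (α : ℂ) ^ 4 * z ^ 2 * e2
  have hα0' : (α : ℂ) ≠ 0 := ofReal_ne_zero.2 hα0
  set W : ℂ → ℂ := fun z => w ((α : ℂ) * z + (β : ℂ)) with hW
  have hline : ∀ z : ℂ, HasDerivAt (fun z => (α : ℂ) * z + (β : ℂ)) α z := fun z => by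
    simpa using ((hasDerivAt_id z).const_mul (α : ℂ)).add_const (β : ℂ)
  have hWd : ∀ z, HasDerivAt W (deriv w (α * z + β) * α) z := fun z =>
    (hw _).hasDerivAt.comp z (hline z)
  have hWdiff : Differentiable ℂ W := fun z => (hWd z).differentiableAt
  have hWode : ∀ z, HasDerivAt (deriv W) ((z ^ 3 - (a : ℂ) * z + (lam : ℂ)) * W z) z := by
    intro z
    rw [funext fun z => (hWd z).deriv]
    refine (((hdw _).hasDerivAt.comp z (hline z)).mul_const (α : ℂ)).congr_deriv ?_
    rw [eq_neg_of_add_eq_zero_left (hode _)]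
    linear_combination (-W z) * hnormal z
  have hbij : Function.Bijective fun z : ℂ => (α : ℂ) * z + (β : ℂ) :=
    ⟨fun x y h => mul_left_cancel₀ hα0' (add_right_cancel h),
      fun y => ⟨(y - β) / α, by simp only; field_simp; ring⟩⟩
  have hpre : {z : ℂ | W z = 0 ∧ z.im ≠ 0} =
      (fun z : ℂ => (α : ℂ) * z + (β : ℂ)) ⁻¹' {z : ℂ | w z = 0 ∧ z.im ≠ 0} := by
    ext z
    simp [hW, hα0]
  have hWfin : {z : ℂ | W z = 0 ∧ z.im ≠ 0}.Finite := by
    rw [hpre]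
    exact hfin.preimage hbij.1.injOn
  have hWcard : {z : ℂ | W z = 0 ∧ z.im ≠ 0}.ncard = 2 * n := by
    rw [hpre, Set.ncard_preimage_of_injective_subset_range hbij.1
      (by rw [hbij.2.range_eq]; exact Set.subset_univ _), hcard]
  have hWinf : {x : ℝ | W x = 0}.Infinite := by
    have hsurj : Function.Surjective fun x : ℝ => α * x + β :=
      fun y => ⟨(y - β) / α, by simp only; field_simp; ring⟩
    have := hinf.preimage (f := fun x : ℝ => α * x + β)
      (by rw [hsurj.range_eq]; exact Set.subset_univ _)
    simpa [hW, Set.preimage] using this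
  obtain ⟨x₀, hx₀⟩ := hWinf.nonempty
  refine ⟨α, β, a, lam, hα0, hnormal, ⟨fun h => hw0 ?_, hWdiff, fun z => (hWode z).deriv,
    tendsto_zero_imaginary_axis hWdiff hWode hx₀ hWfin,
    tendsto_zero_imaginary_axis_atBot hWdiff hWode hx₀ hWfin⟩, hWfin, hWcard, hWinf⟩
  funext z
  obtain ⟨y, rfl⟩ := hbij.2 z
  exact congrFun h y
end

section
/- Let P be a polynomial with complex coefficients of degree 4, and suppose there exist a nonzero entire function w with w''(z) + P(z)·w(z) = 0 for all z ∈ ℂ and a natural number n such that w has exactly 2n zeros in ℂ \ ℝ and infinitely many real zeros. Then there exist α ∈ ℝ \ {0}, β ∈ ℝ and a, c, λ ∈ ℝ such that α²·P(α z + β) = z⁴ − a·z² − c·z − λ for all z ∈ ℂ, and the function W(z) := w(α z + β) is an eigenfunction of the PT-quartic problem at (a,c) with eigenvalue λ (that is, W(i t) → 0 as t → ±∞), having exactly 2n zeros in ℂ \ ℝ. -/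
open Complex Filter

/-- `w` is an eigenfunction of the PT-quartic problem at `(a,c)` with eigenvalue `lam`. -/
def PTQuarticEigenfunction (a c lam : ℝ) (w : ℂ → ℂ) : Prop :=
  w ≠ 0 ∧ Differentiable ℂ w ∧
    (∀ z : ℂ, deriv (deriv w) z =
      (-z ^ 4 + (a : ℂ) * z ^ 2 + (c : ℂ) * z + (lam : ℂ)) * w z) ∧
    Tendsto (fun t : ℝ => w ((t : ℂ) * Complex.I)) atTop (nhds 0) ∧
    Tendsto (fun t : ℝ => w ((t : ℂ) * Complex.I)) atBot (nhds 0)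

section LinearODE

variable {w q : ℂ → ℂ}

/-- Grönwall's inequality for `w'' = q w` along a segment. -/
lemma max_norm_le_of_linear_ode (hw : Differentiable ℂ w)
    (hode : ∀ z, deriv (deriv w) z = q z * w z) (z₀ z : ℂ) {M : ℝ} (hM : 1 ≤ M)
    (hq : ∀ t ∈ Set.Icc (0 : ℝ) 1, ‖q (z₀ + t * (z - z₀))‖ ≤ M) :
    max ‖w z‖ ‖deriv w z‖ ≤ max ‖w z₀‖ ‖deriv w z₀‖ * Real.exp (M * ‖z - z₀‖) := by
  have hw' : Differentiable ℂ (deriv w) := hw.deriv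
  let γ : ℝ → ℂ := fun t => z₀ + t * (z - z₀)
  have hγ : ∀ t, HasDerivAt γ (z - z₀) t := fun t => by
    have h := (((hasDerivAt_id (t : ℂ)).comp_ofReal).mul_const (z - z₀)).const_add z₀
    rw [one_mul] at h
    exact h
  let f : ℝ → ℂ × ℂ := fun t => (w (γ t), deriv w (γ t))
  let f' : ℝ → ℂ × ℂ := fun t =>
    (deriv w (γ t) * (z - z₀), deriv (deriv w) (γ t) * (z - z₀))
  have hf : ∀ t, HasDerivAt f (f' t) t := fun t =>
    (((hw _).hasDerivAt).comp t (hγ t)).prodMk (((hw' _).hasDerivAt).comp t (hγ t))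
  have key := norm_le_gronwallBound_of_norm_deriv_right_le (f := f) (f' := f')
    (δ := ‖f 0‖) (K := M * ‖z - z₀‖) (ε := 0) (a := 0) (b := 1)
    (fun t _ => (hf t).continuousAt.continuousWithinAt)
    (fun t _ => (hf t).hasDerivWithinAt) le_rfl (by
      intro t ht
      have hqt := hq t ⟨ht.1, ht.2.le⟩
      have h1 : ‖w (γ t)‖ ≤ ‖f t‖ := le_max_left _ _
      have h2 : ‖deriv w (γ t)‖ ≤ ‖f t‖ := le_max_right _ _
      have h3 : ‖deriv (deriv w) (γ t)‖ ≤ M * ‖f t‖ := by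
        rw [hode, norm_mul]
        exact mul_le_mul hqt h1 (norm_nonneg _) (by linarith)
      have h4 : ‖deriv w (γ t)‖ ≤ M * ‖f t‖ := by
        nlinarith [norm_nonneg (f t)]
      rw [add_zero]
      refine max_le ?_ ?_
      · change ‖deriv w (γ t) * (z - z₀)‖ ≤ _
        rw [norm_mul]
        nlinarith [norm_nonneg (z - z₀)]
      · change ‖deriv (deriv w) (γ t) * (z - z₀)‖ ≤ _
        rw [norm_mul]
        nlinarith [norm_nonneg (z - z₀)]) 1 (by simp)
  simpa [gronwallBound_ε0, f, γ, Prod.norm_def] using key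

lemma eq_zero_of_linear_ode (hw : Differentiable ℂ w) (hq : Continuous q)
    (hode : ∀ z, deriv (deriv w) z = q z * w z) {z₀ : ℂ} (h0 : w z₀ = 0)
    (h1 : deriv w z₀ = 0) : w = 0 := by
  funext z
  obtain ⟨M, hM⟩ := (isCompact_Icc (a := (0 : ℝ)) (b := 1)).exists_bound_of_continuousOn
    (f := fun t : ℝ => q (z₀ + t * (z - z₀))) (by fun_prop)
  have := max_norm_le_of_linear_ode hw hode z₀ z (le_max_left 1 M)
    (fun t ht => (hM t ht).trans (le_max_right _ _))
  simp only [h0, h1, norm_zero, max_self, zero_mul] at this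
  simpa using (le_max_left _ _).trans this

end LinearODE

/-- A zero-free function on a disc whose modulus is at most `exp A` times its value at the centre
has logarithmic derivative at most `4 * A / ρ` at the centre. -/
lemma norm_logDeriv_le_of_norm_le_exp {w : ℂ → ℂ} (hw : Differentiable ℂ w) {z : ℂ} {ρ A : ℝ}
    (hρ : 0 < ρ) (hA : 0 < A) (hne : ∀ ζ ∈ Metric.ball z ρ, w ζ ≠ 0)
    (hle : ∀ ζ ∈ Metric.ball z ρ, ‖w ζ‖ ≤ ‖w z‖ * Real.exp A) :
    ‖deriv w z / w z‖ ≤ 4 * A / ρ := by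
  have hw' : Differentiable ℂ (deriv w) := hw.deriv
  let u : ℂ → ℂ := fun ζ => w (z + ζ)
  have hmem : ∀ {ζ}, ζ ∈ Metric.ball (0 : ℂ) ρ → z + ζ ∈ Metric.ball z ρ := by
    intro ζ hζ
    simpa [Metric.mem_ball, dist_eq_norm] using hζ
  have hu : ∀ ζ, HasDerivAt u (deriv w (z + ζ)) ζ := fun ζ =>
    ((hw (z + ζ)).hasDerivAt).comp_const_add z ζ
  have hd : DifferentiableOn ℂ (fun ζ => deriv w (z + ζ) / u ζ) (Metric.ball 0 ρ) := by
    intro ζ hζ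
    refine DifferentiableAt.differentiableWithinAt ?_
    refine DifferentiableAt.div (by fun_prop) (hu ζ).differentiableAt (hne _ (hmem hζ))
  obtain ⟨g, hg0, hg⟩ := hd.isExactOn_ball.with_val_at 0 0
  have hdiffg : DifferentiableOn ℂ g (Metric.ball 0 ρ) :=
    fun ζ hζ => (hg ζ hζ).differentiableAt.differentiableWithinAt
  have h0 : (0 : ℂ) ∈ Metric.ball (0 : ℂ) ρ := Metric.mem_ball_self hρ
  have hconst : ∀ ζ ∈ Metric.ball (0 : ℂ) ρ, u ζ * exp (-g ζ) = w z := by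
    intro ζ hζ
    have hder : ∀ x ∈ Metric.ball (0 : ℂ) ρ,
        HasDerivAt (fun ζ => u ζ * exp (-g ζ)) 0 x := by
      intro x hx
      have hux : u x ≠ 0 := hne _ (hmem hx)
      refine ((hu x).mul ((hg x hx).neg.cexp)).congr_deriv ?_
      field_simp
      ring
    have := (convex_ball (0 : ℂ) ρ).is_const_of_fderivWithin_eq_zero (𝕜 := ℂ)
      (f := fun ζ => u ζ * exp (-g ζ))
      (fun x hx => (hder x hx).differentiableAt.differentiableWithinAt)
      (fun x hx => by
        rw [fderivWithin_of_isOpen Metric.isOpen_ball hx]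
        have h := (hder x hx).hasFDerivAt.fderiv
        rw [h]; ext; simp) hζ h0
    simpa [u, hg0] using this
  have hre : Set.MapsTo g (Metric.ball 0 ρ) {z | z.re ≤ A} := by
    intro ζ hζ
    have h1 := hconst ζ hζ
    have h2 := hle _ (hmem hζ)
    have hwz : 0 < ‖w z‖ := norm_pos_iff.2 (hne _ (Metric.mem_ball_self hρ))
    have h3 : u ζ = w z * exp (g ζ) := by
      rw [← h1, mul_assoc, ← exp_add]; simp
    change ‖u ζ‖ ≤ _ at h2
    rw [h3, norm_mul, norm_exp] at h2
    exact Real.exp_le_exp.1 (le_of_mul_le_mul_left h2 hwz)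
  have hsph : ∀ ζ ∈ Metric.sphere (0 : ℂ) (ρ / 2), ‖g ζ‖ ≤ 2 * A := by
    intro ζ hζ
    have hn : ‖ζ‖ = ρ / 2 := by simpa using hζ
    have := borelCaratheodory_zero hA hdiffg hre hρ (z := ζ) (by simp [hn, hρ]) hg0
    rw [hn] at this
    refine this.trans (le_of_eq ?_)
    field_simp
    ring
  have hcl : DiffContOnCl ℂ g (Metric.ball 0 (ρ / 2)) := by
    refine (hdiffg.mono ?_).diffContOnCl
    rw [closure_ball _ (by positivity)]
    exact Metric.closedBall_subset_ball (by linarith)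
  have := norm_deriv_le_of_forall_mem_sphere_norm_le (by positivity) hcl hsph
  rw [(hg 0 h0).deriv] at this
  simp only [u, add_zero] at this
  refine this.trans (le_of_eq ?_)
  field_simp
  ring

section QuarticGrowth

variable {w q : ℂ → ℂ} {K R : ℝ}

lemma max_norm_le_exp_of_quartic (hw : Differentiable ℂ w)
    (hode : ∀ z, deriv (deriv w) z = q z * w z) (hK : 1 ≤ K)
    (hq : ∀ z, ‖q z‖ ≤ K * (1 + ‖z‖) ^ 4) (z : ℂ) :
    max ‖w z‖ ‖deriv w z‖ ≤ max ‖w 0‖ ‖deriv w 0‖ * Real.exp (K * (1 + ‖z‖) ^ 5) := by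
  have h1 : 1 ≤ (1 + ‖z‖) ^ 4 := one_le_pow₀ (by linarith [norm_nonneg z])
  have := max_norm_le_of_linear_ode hw hode 0 z (M := K * (1 + ‖z‖) ^ 4) (by nlinarith) (by
    intro t ht
    refine (hq _).trans ?_
    have : ‖(0 : ℂ) + t * (z - 0)‖ ≤ ‖z‖ := by
      simp only [zero_add, sub_zero, norm_mul, norm_real, Real.norm_eq_abs, abs_of_nonneg ht.1]
      nlinarith [norm_nonneg z, ht.2]
    gcongr)
  have h2 : K * (1 + ‖z‖) ^ 4 * ‖z - 0‖ ≤ K * (1 + ‖z‖) ^ 5 := by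
    rw [sub_zero, pow_succ _ 4, ← mul_assoc]
    exact mul_le_mul_of_nonneg_left (by linarith) (by positivity)
  exact this.trans (mul_le_mul_of_nonneg_left (Real.exp_le_exp.2 h2) (by positivity))

lemma half_norm_le_of_mem_closedBall {ε : ℝ} (hε : 0 < ε) (hε1 : ε ≤ 1) {z ζ : ℂ}
    (hζ : ‖ζ - z‖ ≤ ε * ‖z‖ / 2) (hz : ε * ‖z‖ ≤ z.im) :
    ‖z‖ / 2 ≤ ‖ζ‖ ∧ ‖ζ‖ ≤ 2 * ‖z‖ ∧ ε * ‖z‖ / 2 ≤ ζ.im := by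
  have h1 : ‖ζ‖ ≤ ‖ζ - z‖ + ‖z‖ := norm_le_norm_sub_add ζ z
  have h2 : ‖z‖ ≤ ‖z - ζ‖ + ‖ζ‖ := norm_le_norm_sub_add z ζ
  rw [norm_sub_rev] at h2
  have h3 := (abs_le.1 (abs_im_le_norm (ζ - z))).1
  rw [sub_im] at h3
  have := norm_nonneg z
  refine ⟨by nlinarith, by nlinarith, by nlinarith⟩

/-- In a sector of the upper half-plane where `w` is zero-free, a solution of `w'' = q w` with
quartic `q` has logarithmic derivative `O(|z| ^ 4)`. -/
lemma norm_logDeriv_le_of_quartic (hw : Differentiable ℂ w)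
    (hode : ∀ z, deriv (deriv w) z = q z * w z) (hK : 1 ≤ K)
    (hq : ∀ z, ‖q z‖ ≤ K * (1 + ‖z‖) ^ 4)
    (hne : ∀ z : ℂ, 0 < z.im → R < ‖z‖ → w z ≠ 0) {ε : ℝ} (hε : 0 < ε) (hε1 : ε ≤ 1) :
    ∃ R', 1 ≤ R' ∧ R < R' ∧ ∀ z : ℂ, ε * ‖z‖ ≤ z.im → R' ≤ ‖z‖ →
      ‖deriv w z / w z‖ ≤ 648 * K * ‖z‖ ^ 4 := by
  refine ⟨max 1 (max (2 * |R| + 1) (16 / ε)), le_max_left _ _, ?_, fun z hz hzR => ?_⟩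
  · refine lt_of_lt_of_le ?_ ((le_max_left _ _).trans (le_max_right _ _))
    linarith [le_abs_self R, abs_nonneg R]
  have hz1 : 1 ≤ ‖z‖ := (le_max_left _ _).trans hzR
  have hz2 : 2 * |R| + 1 ≤ ‖z‖ := ((le_max_left _ _).trans (le_max_right _ _)).trans hzR
  have hz3 : 16 / ε ≤ ‖z‖ := ((le_max_right _ _).trans (le_max_right _ _)).trans hzR
  rw [div_le_iff₀ hε] at hz3
  set ρ := ε * ‖z‖ / 2 with hρdef
  have hρ : 8 ≤ ρ := by rw [hρdef]; linarith
  have hball : ∀ ζ : ℂ, ‖ζ - z‖ ≤ ρ → ‖z‖ / 2 ≤ ‖ζ‖ ∧ ‖ζ‖ ≤ 2 * ‖z‖ ∧ ρ ≤ ζ.im :=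
    fun ζ hζ => half_norm_le_of_mem_closedBall hε hε1 hζ hz
  have hwne : ∀ ζ : ℂ, ‖ζ - z‖ ≤ ρ → w ζ ≠ 0 := fun ζ hζ => by
    obtain ⟨h1, -, h3⟩ := hball ζ hζ
    exact hne ζ (by linarith) (by linarith [le_abs_self R])
  set M := 81 * K * ‖z‖ ^ 4 with hMdef
  have hM1 : 1 ≤ M := by
    have := one_le_pow₀ (n := 4) hz1
    rw [hMdef]; nlinarith
  have hwz : 0 < ‖w z‖ := norm_pos_iff.2 (hwne z (by simp; linarith))
  have hsub : ∀ ζ ∈ Metric.ball z ρ, ‖w ζ‖ ≤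
      ‖w z‖ * Real.exp (‖deriv w z / w z‖ + M * ρ) := by
    intro ζ hζ
    rw [Metric.mem_ball, dist_eq_norm] at hζ
    have h := max_norm_le_of_linear_ode hw hode z ζ hM1 (by
      intro t ht
      refine (hq _).trans ?_
      have hn : ‖z + t * (ζ - z)‖ ≤ 2 * ‖z‖ := by
        refine (hball _ ?_).2.1
        rw [add_sub_cancel_left, norm_mul, norm_real, Real.norm_eq_abs, abs_of_nonneg ht.1]
        nlinarith [norm_nonneg (ζ - z), ht.2]
      calc K * (1 + ‖z + t * (ζ - z)‖) ^ 4 ≤ K * (3 * ‖z‖) ^ 4 := by gcongr; linarith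
        _ = M := by rw [hMdef]; ring)
    have h2 : max ‖w z‖ ‖deriv w z‖ ≤ ‖w z‖ * Real.exp ‖deriv w z / w z‖ := by
      have h3 := Real.add_one_le_exp ‖deriv w z / w z‖
      have h4 : ‖deriv w z‖ = ‖w z‖ * ‖deriv w z / w z‖ := by
        rw [norm_div]; field_simp
      have h5 := norm_nonneg (deriv w z / w z)
      refine max_le (by nlinarith) ?_
      rw [h4]; gcongr; linarith
    calc ‖w ζ‖ ≤ max ‖w z‖ ‖deriv w z‖ * Real.exp (M * ‖ζ - z‖) := (le_max_left _ _).trans h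
      _ ≤ (‖w z‖ * Real.exp ‖deriv w z / w z‖) * Real.exp (M * ρ) := by gcongr
      _ = _ := by rw [mul_assoc, Real.exp_add]
  have key := norm_logDeriv_le_of_norm_le_exp hw (by linarith)
    (by have := norm_nonneg (deriv w z / w z); positivity)
    (fun ζ hζ => hwne ζ (by rw [Metric.mem_ball, dist_eq_norm] at hζ; exact hζ.le)) hsub
  rw [le_div_iff₀ (by linarith)] at key
  have h0 := norm_nonneg (deriv w z / w z)
  have h1 : ‖deriv w z / w z‖ * ρ ≤ 8 * M * ρ := by nlinarith
  have := le_of_mul_le_mul_right h1 (by linarith)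
  rw [hMdef] at this
  linarith

/-- The Riccati equation forces `(w' / w) ^ 2 ~ -z ^ 4` in zero-free sectors. -/
lemma norm_logDeriv_div_sq_add_one_le (hw : Differentiable ℂ w)
    (hode : ∀ z, deriv (deriv w) z = q z * w z) (hK : 1 ≤ K)
    (hq : ∀ z, ‖q z‖ ≤ K * (1 + ‖z‖) ^ 4) (hq' : ∀ z, ‖q z + z ^ 4‖ ≤ K * (1 + ‖z‖) ^ 2)
    (hne : ∀ z : ℂ, 0 < z.im → R < ‖z‖ → w z ≠ 0) {ε δ : ℝ} (hε : 0 < ε) (hε1 : ε ≤ 1)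
    (hδ : 0 < δ) :
    ∃ R', 1 ≤ R' ∧ R < R' ∧ ∀ z : ℂ, ε * ‖z‖ ≤ z.im → R' ≤ ‖z‖ →
      ‖(deriv w z / w z / z ^ 2) ^ 2 + 1‖ ≤ δ := by
  obtain ⟨R₁, hR₁, hRR₁, hb⟩ := norm_logDeriv_le_of_quartic hw hode hK hq hne
    (ε := ε / 4) (by positivity) (by linarith)
  set C := 4 * K + 32 * 648 * K / ε with hC
  have hC0 : 0 < C := by positivity
  refine ⟨max (2 * R₁) (C / δ), by have := le_max_left (2 * R₁) (C / δ); linarith,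
    by have := le_max_left (2 * R₁) (C / δ); linarith, fun z hz hzR => ?_⟩
  have hz1 : 2 * R₁ ≤ ‖z‖ := (le_max_left _ _).trans hzR
  have hz2 : C / δ ≤ ‖z‖ := (le_max_right _ _).trans hzR
  rw [div_le_iff₀ hδ] at hz2
  have hz0 : 0 < ‖z‖ := by linarith
  have hzne : z ≠ 0 := norm_pos_iff.1 hz0
  set ρ := ε * ‖z‖ / 2 with hρdef
  have hρ : 0 < ρ := by positivity
  have hball : ∀ ζ : ℂ, ‖ζ - z‖ ≤ ρ → ‖z‖ / 2 ≤ ‖ζ‖ ∧ ‖ζ‖ ≤ 2 * ‖z‖ ∧ ρ ≤ ζ.im :=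
    fun ζ hζ => half_norm_le_of_mem_closedBall hε hε1 hζ hz
  have hwne : ∀ ζ : ℂ, ‖ζ - z‖ ≤ ρ → w ζ ≠ 0 := fun ζ hζ => by
    obtain ⟨h1, -, h3⟩ := hball ζ hζ
    exact hne ζ (by linarith) (by linarith)
  have hwz : w z ≠ 0 := hwne z (by simpa using hρ.le)
  have hw' : Differentiable ℂ (deriv w) := hw.deriv
  let h : ℂ → ℂ := fun ζ => deriv w ζ / w ζ
  have hcauchy : ‖deriv h z‖ ≤ 648 * K * (2 * ‖z‖) ^ 4 / ρ := by
    refine norm_deriv_le_of_forall_mem_sphere_norm_le hρ ?_ ?_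
    · refine DifferentiableOn.diffContOnCl fun ζ hζ => ?_
      rw [closure_ball _ hρ.ne', Metric.mem_closedBall, dist_eq_norm] at hζ
      exact ((hw' ζ).div (hw ζ) (hwne ζ hζ)).differentiableWithinAt
    · intro ζ hζ
      rw [mem_sphere_iff_norm] at hζ
      obtain ⟨h1, h2, h3⟩ := hball ζ hζ.le
      refine (hb ζ ?_ (by linarith)).trans (by gcongr)
      rw [hρdef] at h3
      nlinarith
  have hder : deriv h z = q z - h z ^ 2 := by
    have := ((hw' z).hasDerivAt.div (hw z).hasDerivAt hwz).deriv
    change deriv h z = _ at this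
    rw [this, hode]
    simp only [h]
    field_simp
  have hsq : (h z / z ^ 2) ^ 2 + 1 = ((q z + z ^ 4) - deriv h z) / z ^ 4 := by
    rw [hder]; field_simp; ring
  change ‖(h z / z ^ 2) ^ 2 + 1‖ ≤ δ
  rw [hsq, norm_div, norm_pow, div_le_iff₀ (by positivity)]
  have h1 : K * (1 + ‖z‖) ^ 2 ≤ 4 * K * ‖z‖ ^ 3 := by
    have : (1 + ‖z‖) ^ 2 ≤ (2 * ‖z‖) ^ 2 := by gcongr; linarith
    have h3 : ‖z‖ ^ 2 ≤ ‖z‖ ^ 3 := pow_le_pow_right₀ (by linarith) (by norm_num)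
    nlinarith
  have h2 : 648 * K * (2 * ‖z‖) ^ 4 / ρ = 32 * 648 * K / ε * ‖z‖ ^ 3 := by
    rw [hρdef]; field_simp; ring
  calc ‖(q z + z ^ 4) - deriv h z‖ ≤ ‖q z + z ^ 4‖ + ‖deriv h z‖ := norm_sub_le _ _
    _ ≤ 4 * K * ‖z‖ ^ 3 + 32 * 648 * K / ε * ‖z‖ ^ 3 := by
      rw [← h2]; exact add_le_add ((hq' z).trans h1) hcauchy
    _ = C * ‖z‖ ^ 3 := by rw [hC]; ring
    _ ≤ ‖z‖ * δ * ‖z‖ ^ 3 := by gcongr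
    _ = δ * ‖z‖ ^ 4 := by ring

lemma im_ne_zero_of_norm_sq_add_one_lt {x : ℂ} (hx : ‖x ^ 2 + 1‖ < 1) : x.im ≠ 0 := by
  intro h
  have : (x ^ 2 + 1).re = x.re ^ 2 + 1 := by simp [pow_two, h]
  have h1 := re_le_norm (x ^ 2 + 1)
  rw [this] at h1
  nlinarith [sq_nonneg x.re]

lemma norm_sub_I_le_of_im_pos {x : ℂ} (hx : 0 < x.im) : ‖x - I‖ ≤ ‖x ^ 2 + 1‖ := by
  have h1 : x ^ 2 + 1 = (x - I) * (x + I) := by linear_combination I_sq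
  have h2 := im_le_norm (x + I)
  rw [add_im, I_im] at h2
  rw [h1, norm_mul]
  nlinarith [norm_nonneg (x - I)]

lemma norm_add_I_le_of_im_neg {x : ℂ} (hx : x.im < 0) : ‖x + I‖ ≤ ‖x ^ 2 + 1‖ := by
  have := norm_sub_I_le_of_im_pos (x := -x) (by simpa using hx)
  rwa [neg_sq, ← norm_neg, neg_sub, sub_neg_eq_add, add_comm I] at this

/-- WKB dichotomy: `w' / w` is close either to `i z ^ 2` or to `-i z ^ 2` throughout a
zero-free sector. -/
lemma logDeriv_dichotomy (hw : Differentiable ℂ w)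
    (hode : ∀ z, deriv (deriv w) z = q z * w z) (hK : 1 ≤ K)
    (hq : ∀ z, ‖q z‖ ≤ K * (1 + ‖z‖) ^ 4) (hq' : ∀ z, ‖q z + z ^ 4‖ ≤ K * (1 + ‖z‖) ^ 2)
    (hne : ∀ z : ℂ, 0 < z.im → R < ‖z‖ → w z ≠ 0) {θ₀ : ℝ} (hθ₀ : 0 < θ₀) :
    ∃ R', 1 ≤ R' ∧
      (∀ r θ : ℝ, R' ≤ r → θ ∈ Set.Icc θ₀ (Real.pi / 2) → w (r * exp (θ * I)) ≠ 0) ∧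
      ((∀ r θ : ℝ, R' ≤ r → θ ∈ Set.Icc θ₀ (Real.pi / 2) →
        ‖deriv w (r * exp (θ * I)) / w (r * exp (θ * I)) / (r * exp (θ * I)) ^ 2 - I‖ ≤ 1 / 2) ∨
      (∀ r θ : ℝ, R' ≤ r → θ ∈ Set.Icc θ₀ (Real.pi / 2) →
        ‖deriv w (r * exp (θ * I)) / w (r * exp (θ * I)) / (r * exp (θ * I)) ^ 2 + I‖
          ≤ 1 / 2)) := by
  by_cases hθ : θ₀ ≤ Real.pi / 2
  swap
  · have : ∀ θ, θ ∉ Set.Icc θ₀ (Real.pi / 2) := fun θ h => hθ (h.1.trans h.2)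
    exact ⟨1, le_rfl, fun _ θ _ h => (this θ h).elim, Or.inl fun _ θ _ h => (this θ h).elim⟩
  have hs : 0 < Real.sin θ₀ := Real.sin_pos_of_pos_of_lt_pi hθ₀ (by linarith [Real.pi_pos])
  obtain ⟨R', hR1, hRR, hb⟩ := norm_logDeriv_div_sq_add_one_le hw hode hK hq hq' hne hs
    (Real.sin_le_one _) (δ := 1 / 2) (by norm_num)
  let p : ℝ × ℝ → ℂ := fun x => x.1 * exp (x.2 * I)
  let S : Set (ℝ × ℝ) := Set.Ici R' ×ˢ Set.Icc θ₀ (Real.pi / 2)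
  have hnorm : ∀ x ∈ S, ‖p x‖ = x.1 := fun x hx => by
    have : 0 ≤ x.1 := by have : R' ≤ x.1 := hx.1; linarith
    simp [p, norm_exp_ofReal_mul_I, abs_of_nonneg this]
  have him : ∀ x ∈ S, Real.sin θ₀ * ‖p x‖ ≤ (p x).im := fun x hx => by
    have h0 : R' ≤ x.1 := hx.1
    have h1 : (p x).im = x.1 * Real.sin x.2 := by
      simp [p, exp_ofReal_mul_I_im]
    have h2 : Real.sin θ₀ ≤ Real.sin x.2 :=
      Real.sin_le_sin_of_le_of_le_pi_div_two (by linarith [Real.pi_pos]) hx.2.2 hx.2.1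
    rw [hnorm x hx, h1, mul_comm]
    gcongr
    linarith
  have hwne : ∀ x ∈ S, w (p x) ≠ 0 := fun x hx => by
    have h0 : R' ≤ x.1 := hx.1
    refine hne _ (lt_of_lt_of_le ?_ (him x hx)) (by rw [hnorm x hx]; linarith)
    rw [hnorm x hx]; nlinarith
  have hb' : ∀ x ∈ S, ‖(deriv w (p x) / w (p x) / p x ^ 2) ^ 2 + 1‖ ≤ 1 / 2 := fun x hx =>
    hb _ (him x hx) (by rw [hnorm x hx]; exact hx.1)
  have hp : Continuous p := by fun_prop
  have hcont : ContinuousOn (fun x => (deriv w (p x) / w (p x) / p x ^ 2).im) S := by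
    refine Complex.continuous_im.comp_continuousOn ?_
    refine ContinuousOn.div (ContinuousOn.div ?_ ?_ hwne) (by fun_prop) ?_
    · exact (hw.deriv.continuous.comp hp).continuousOn
    · exact (hw.continuous.comp hp).continuousOn
    · intro x hx h
      have h0 : R' ≤ x.1 := hx.1
      have h1 : ‖p x‖ = 0 := by rw [norm_eq_zero]; exact pow_eq_zero_iff (by norm_num) |>.1 h
      rw [hnorm x hx] at h1; linarith
  have hpre : IsPreconnected S := isPreconnected_Ici.prod isPreconnected_Icc
  have hne0 : ∀ x ∈ S, (deriv w (p x) / w (p x) / p x ^ 2).im ≠ 0 := fun x hx =>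
    im_ne_zero_of_norm_sq_add_one_lt ((hb' x hx).trans_lt (by norm_num))
  refine ⟨R', hR1, fun r θ hr h => hwne (r, θ) ⟨hr, h⟩, ?_⟩
  by_cases hall : ∀ x ∈ S, 0 < (deriv w (p x) / w (p x) / p x ^ 2).im
  · exact Or.inl fun r θ hr h =>
      (norm_sub_I_le_of_im_pos (hall (r, θ) ⟨hr, h⟩)).trans (hb' (r, θ) ⟨hr, h⟩)
  · push Not at hall
    obtain ⟨x, hx, hx0⟩ := hall
    have hall' : ∀ y ∈ S, (deriv w (p y) / w (p y) / p y ^ 2).im < 0 := by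
      intro y hy
      by_contra hcon
      push Not at hcon
      obtain ⟨s, hs, hs0⟩ := hpre.intermediate_value hx hy hcont ⟨hx0, hcon⟩
      exact hne0 s hs hs0
    exact Or.inr fun r θ hr h =>
      (norm_add_I_le_of_im_neg (hall' (r, θ) ⟨hr, h⟩)).trans (hb' (r, θ) ⟨hr, h⟩)

end QuarticGrowth

section Decay

variable {w q : ℂ → ℂ} {K R : ℝ}

/-- If `Re (u w' / w) ≤ - t ^ 2 / 5` along the ray spanned by `u`, then `w` decays at least like
`t ^ (-6)` on it. -/
lemma norm_le_div_pow_of_re_logDeriv_le (hw : Differentiable ℂ w) {u : ℂ}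
    (hne : ∀ t : ℝ, R ≤ t → w (t * u) ≠ 0)
    (hre : ∀ t : ℝ, R ≤ t → (u * (deriv w (t * u) / w (t * u))).re ≤ -(t ^ 2 / 5)) :
    ∃ C, 0 ≤ C ∧ ∀ t : ℝ, max R 4 ≤ t → ‖w (t * u)‖ ≤ C / t ^ 6 := by
  have hlin : ∀ t : ℝ, HasDerivAt (fun t : ℝ => (t : ℂ) * u) u t := fun t => by
    simpa using ((hasDerivAt_id (t : ℂ)).comp_ofReal).mul_const u
  let y : ℝ → ℂ := fun t => w (t * u)
  have hy : ∀ t : ℝ, HasDerivAt y (deriv w (t * u) * u) t := fun t =>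
    ((hw _).hasDerivAt).comp t (hlin t)
  let φ : ℝ → ℝ := fun t => t ^ 12 * ‖y t‖ ^ 2
  have hφ : ∀ t, HasDerivAt φ (12 * t ^ 11 * ‖y t‖ ^ 2 +
      t ^ 12 * (2 * inner ℝ (y t) (deriv w (t * u) * u))) t := fun t => by
    have := (hasDerivAt_pow 12 t).mul (hy t).norm_sq
    exact this
  have hanti : AntitoneOn φ (Set.Ici (max R 4)) := by
    refine antitoneOn_of_deriv_nonpos (convex_Ici _)
      (fun t _ => (hφ t).continuousAt.continuousWithinAt)
      (fun t _ => (hφ t).differentiableAt.differentiableWithinAt) fun t ht => ?_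
    rw [interior_Ici, Set.mem_Ioi, max_lt_iff] at ht
    rw [(hφ t).deriv]
    have h1 := hre t ht.1.le
    have hyne : w (t * u) ≠ 0 := hne t ht.1.le
    have h2 : inner ℝ (y t) (deriv w (t * u) * u) =
        ‖y t‖ ^ 2 * (u * (deriv w (t * u) / w (t * u))).re := by
      have : deriv w (t * u) * u = y t * (u * (deriv w (t * u) / w (t * u))) := by
        simp only [y]; field_simp
      rw [this, real_inner_eq_re_inner ℂ, RCLike.inner_apply', ← mul_assoc]
      change (starRingEnd ℂ (y t) * y t * _).re = _
      rw [← normSq_eq_conj_mul_self, normSq_eq_norm_sq, re_ofReal_mul]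
    rw [h2]
    have ht4 := ht.2
    have h3 : 0 ≤ t ^ 11 * ‖y t‖ ^ 2 := by positivity
    have h4 : t * (u * (deriv w (t * u) / w (t * u))).re ≤ -6 := by
      have h5 : (4 : ℝ) ^ 3 ≤ t ^ 3 := by gcongr
      nlinarith
    nlinarith
  refine ⟨Real.sqrt (φ (max R 4)), Real.sqrt_nonneg _, fun t ht => ?_⟩
  have ht0 : 0 < t := by linarith [le_max_right R 4]
  rw [le_div_iff₀ (by positivity)]
  refine Real.le_sqrt_of_sq_le ?_
  have := hanti (Set.mem_Ici.2 le_rfl) (Set.mem_Ici.2 ht) ht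
  refine le_trans (le_of_eq ?_) this
  simp only [φ, y]; ring

/-- Phragmén–Lindelöf in the sector `|arg z| ≤ π / 12` for functions of order at most five. -/
lemma norm_le_of_sector {f : ℂ → ℂ} (hf : Differentiable ℂ f) {A B M : ℝ} (hA : 0 ≤ A)
    (hB : 0 ≤ B) (hgrow : ∀ z, ‖f z‖ ≤ A * Real.exp (B * (1 + ‖z‖) ^ 5))
    (hpos : ∀ r : ℝ, 0 < r → ‖f (r * exp ((Real.pi / 12 : ℝ) * I))‖ ≤ M)
    (hneg : ∀ r : ℝ, 0 < r → ‖f (r * exp ((-(Real.pi / 12) : ℝ) * I))‖ ≤ M)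
    {x : ℝ} (hx : 0 < x) : ‖f x‖ ≤ M := by
  have hpi := Real.pi_pos
  have hform : ∀ ζ : ℂ, exp ζ = (Real.exp ζ.re : ℝ) * exp ((ζ.im : ℝ) * I) := fun ζ => by
    rw [ofReal_exp, ← exp_add, re_add_im]
  have key := PhragmenLindelof.horizontal_strip (f := fun ζ => f (exp ζ)) (C := M)
    (a := -(Real.pi / 12)) (b := Real.pi / 12) (z := (Real.log x : ℝ))
    ((hf.comp differentiable_exp).diffContOnCl) ?_ ?_ ?_ ?_ ?_
  · simpa [← ofReal_exp, Real.exp_log hx] using key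
  · refine ⟨5, ?_, B * 32, ?_⟩
    · rw [lt_div_iff₀ (by linarith)]; linarith
    · refine Asymptotics.IsBigO.of_bound A (Eventually.of_forall fun ζ => ?_)
      rw [Real.norm_eq_abs, Real.abs_exp]
      refine (hgrow _).trans ?_
      have h1 : ‖exp ζ‖ ≤ Real.exp |ζ.re| := by
        rw [norm_exp]; exact Real.exp_le_exp.2 (le_abs_self _)
      have h2 : 1 ≤ Real.exp |ζ.re| := Real.one_le_exp (abs_nonneg _)
      have h3 : (1 + ‖exp ζ‖) ^ 5 ≤ 32 * Real.exp (5 * |ζ.re|) := by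
        calc (1 + ‖exp ζ‖) ^ 5 ≤ (2 * Real.exp |ζ.re|) ^ 5 := by gcongr; linarith
          _ = 32 * Real.exp (5 * |ζ.re|) := by
            rw [mul_pow, ← Real.exp_nat_mul]; norm_num
      rw [mul_assoc]
      gcongr
  · intro ζ hζ
    rw [hform ζ, hζ]
    exact hneg _ (Real.exp_pos _)
  · intro ζ hζ
    rw [hform ζ, hζ]
    exact hpos _ (Real.exp_pos _)
  · rw [ofReal_im]; linarith
  · rw [ofReal_im]; linarith

lemma exists_bound_on_ray {f : ℂ → ℂ} (hf : Continuous f) {u : ℂ} {T M : ℝ}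
    (h : ∀ r : ℝ, T ≤ r → ‖f (r * u)‖ ≤ M) : ∃ M', ∀ r : ℝ, 0 < r → ‖f (r * u)‖ ≤ M' := by
  obtain ⟨M₁, hM₁⟩ := (isCompact_Icc (a := (0 : ℝ)) (b := T)).exists_bound_of_continuousOn
    (f := fun t : ℝ => f (t * u)) (by fun_prop)
  refine ⟨max M M₁, fun r hr => ?_⟩
  rcases le_total T r with hT | hT
  · exact (h r hT).trans (le_max_left _ _)
  · exact (hM₁ r ⟨hr.le, hT⟩).trans (le_max_right _ _)

/-- A solution of `w'' = q w`, with `q` real and `-q` nondecreasing and positive near `+∞`,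
cannot decay together with `sqrt (-q) w` and `w'` along the positive real axis. -/
lemma eq_zero_of_energy_tendsto_zero (hw : Differentiable ℂ w) (hqc : Continuous q)
    (hode : ∀ z, deriv (deriv w) z = q z * w z) {g g' : ℝ → ℝ}
    (hqg : ∀ x : ℝ, q x = -(g x : ℂ)) (hg : ∀ x, HasDerivAt g (g' x) x) {X : ℝ}
    (hg0 : ∀ x, X ≤ x → 0 < g x) (hg'0 : ∀ x, X ≤ x → 0 ≤ g' x)
    (hlim : Tendsto (fun x : ℝ => ‖deriv w x‖ ^ 2 + g x * ‖w x‖ ^ 2) atTop (nhds 0)) :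
    w = 0 := by
  let E : ℝ → ℝ := fun x => ‖deriv w x‖ ^ 2 + g x * ‖w x‖ ^ 2
  have h1 : ∀ x : ℝ, HasDerivAt (fun x : ℝ => w x) (deriv w x) x := fun x =>
    ((hw _).hasDerivAt).comp_ofReal
  have h2 : ∀ x : ℝ, HasDerivAt (fun x : ℝ => deriv w x) (deriv (deriv w) x) x := fun x =>
    ((hw.deriv _).hasDerivAt).comp_ofReal
  have hE : ∀ x, HasDerivAt E (g' x * ‖w x‖ ^ 2) x := fun x => by
    have := (h2 x).norm_sq.add ((hg x).mul (h1 x).norm_sq)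
    refine HasDerivAt.congr_deriv (f := E) this ?_
    rw [hode, hqg, Complex.inner, Complex.inner]
    simp only [mul_re, mul_im, conj_re, conj_im, neg_re, neg_im, ofReal_re, ofReal_im]
    ring
  have hmono : MonotoneOn E (Set.Ici X) := by
    refine monotoneOn_of_deriv_nonneg (convex_Ici _)
      (fun t _ => (hE t).continuousAt.continuousWithinAt)
      (fun t _ => (hE t).differentiableAt.differentiableWithinAt) fun t ht => ?_
    rw [interior_Ici, Set.mem_Ioi] at ht
    rw [(hE t).deriv]
    have := hg'0 t ht.le
    positivity
  have hEX : E X ≤ 0 := by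
    refine ge_of_tendsto hlim ?_
    filter_upwards [eventually_ge_atTop X] with x hx
    exact hmono (Set.mem_Ici.2 le_rfl) (Set.mem_Ici.2 hx) hx
  have hgX := hg0 X le_rfl
  have h3 : 0 ≤ ‖deriv w X‖ ^ 2 := by positivity
  have h4 : 0 ≤ g X * ‖w X‖ ^ 2 := by positivity
  have h5 : ‖deriv w X‖ ^ 2 + g X * ‖w X‖ ^ 2 ≤ 0 := hEX
  refine eq_zero_of_linear_ode hw hqc hode (z₀ := (X : ℂ)) ?_ ?_
  · have h6 : g X * ‖w X‖ ^ 2 = 0 := by linarith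
    simpa [hgX.ne'] using h6
  · have h6 : ‖deriv w X‖ ^ 2 = 0 := by linarith
    simpa using h6

end Decay

section NormalForm

variable {w : ℂ → ℂ} {a c lam : ℝ}

lemma norm_quartic_add_pow_le (z : ℂ) :
    ‖-z ^ 4 + (a : ℂ) * z ^ 2 + (c : ℂ) * z + (lam : ℂ) + z ^ 4‖
      ≤ (1 + (|a| + |c| + |lam|)) * (1 + ‖z‖) ^ 2 := by
  have h : -z ^ 4 + (a : ℂ) * z ^ 2 + (c : ℂ) * z + (lam : ℂ) + z ^ 4
      = (a : ℂ) * z ^ 2 + (c : ℂ) * z + (lam : ℂ) := by ring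
  rw [h]
  refine (norm_add₃_le).trans ?_
  simp only [norm_mul, norm_pow, norm_real, Real.norm_eq_abs]
  have h0 := norm_nonneg z
  nlinarith [abs_nonneg a, abs_nonneg c, abs_nonneg lam, mul_nonneg (abs_nonneg a) h0,
    mul_nonneg (abs_nonneg c) h0, mul_nonneg (abs_nonneg lam) h0,
    mul_nonneg (abs_nonneg c) (sq_nonneg ‖z‖), mul_nonneg (abs_nonneg lam) (sq_nonneg ‖z‖)]

lemma norm_quartic_le (z : ℂ) :
    ‖-z ^ 4 + (a : ℂ) * z ^ 2 + (c : ℂ) * z + (lam : ℂ)‖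
      ≤ (1 + (1 + (|a| + |c| + |lam|))) * (1 + ‖z‖) ^ 4 := by
  have h1 := norm_quartic_add_pow_le (a := a) (c := c) (lam := lam) z
  have h2 := norm_sub_le (-z ^ 4 + (a : ℂ) * z ^ 2 + (c : ℂ) * z + (lam : ℂ) + z ^ 4) (z ^ 4)
  rw [add_sub_cancel_right, norm_pow] at h2
  have h0 := norm_nonneg z
  have h3 : ‖z‖ ^ 4 ≤ (1 + ‖z‖) ^ 4 := by gcongr; linarith
  have h4 : (1 + ‖z‖) ^ 2 ≤ (1 + ‖z‖) ^ 4 := pow_le_pow_right₀ (by linarith) (by norm_num)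
  have h5 : (1 + (|a| + |c| + |lam|)) * (1 + ‖z‖) ^ 2 ≤
    (1 + (|a| + |c| + |lam|)) * (1 + ‖z‖) ^ 4 := by gcongr
  linarith

lemma pow_mul_exp_le {x K A B : ℝ} {k : ℕ} (hk : k ≤ 5) (hx : 0 ≤ x) (hA : 0 ≤ A)
    (hB : B ≤ A * Real.exp (K * (1 + x) ^ 5)) :
    x ^ k * B ≤ A * Real.exp ((K + 1) * (1 + x) ^ 5) := by
  have h1 : x ^ k ≤ Real.exp ((1 + x) ^ 5) := by
    calc x ^ k ≤ (1 + x) ^ k := by gcongr; linarith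
      _ ≤ (1 + x) ^ 5 := pow_le_pow_right₀ (by linarith) hk
      _ ≤ Real.exp ((1 + x) ^ 5) := by linarith [Real.add_one_le_exp ((1 + x) ^ 5)]
  calc x ^ k * B ≤ x ^ k * (A * Real.exp (K * (1 + x) ^ 5)) := by gcongr
    _ ≤ Real.exp ((1 + x) ^ 5) * (A * Real.exp (K * (1 + x) ^ 5)) := by gcongr
    _ = A * Real.exp ((K + 1) * (1 + x) ^ 5) := by
      rw [add_mul, one_mul, Real.exp_add]; ring

lemma deriv_conj_eq (hw : Differentiable ℂ w) {k : ℂ}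
    (hsym : ∀ z, starRingEnd ℂ (w (starRingEnd ℂ z)) = k * w z) (z : ℂ) :
    starRingEnd ℂ (deriv w (starRingEnd ℂ z)) = k * deriv w z := by
  have h1 := ((hw (starRingEnd ℂ z)).hasDerivAt).conj_conj
  rw [conj_conj] at h1
  have h2 := ((hw z).hasDerivAt).const_mul k
  have h3 : starRingEnd ℂ ∘ w ∘ starRingEnd ℂ = fun z => k * w z := funext hsym
  rw [h3] at h1
  exact h1.unique h2

lemma tendsto_const_div_sq_atTop (C : ℝ) :
    Tendsto (fun x : ℝ => C / x ^ 2) atTop (nhds 0) :=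
  tendsto_const_nhds.div_atTop (tendsto_pow_atTop two_ne_zero)

/-- The normal-form quartic has no solution that is symmetric about the real axis and decays,
along with its derivative, on the ray `arg z = π / 12`. -/
lemma eq_zero_of_decay_on_ray (hw : Differentiable ℂ w)
    (hode : ∀ z : ℂ, deriv (deriv w) z =
      (-z ^ 4 + (a : ℂ) * z ^ 2 + (c : ℂ) * z + (lam : ℂ)) * w z) {k : ℂ} (hk : ‖k‖ = 1)
    (hsym : ∀ z, starRingEnd ℂ (w (starRingEnd ℂ z)) = k * w z) {T C : ℝ} (hT : 1 ≤ T)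
    (hdec : ∀ r : ℝ, T ≤ r → ‖w (r * exp ((Real.pi / 12 : ℝ) * I))‖ ≤ C / r ^ 3)
    (hdec' : ∀ r : ℝ, T ≤ r → ‖deriv w (r * exp ((Real.pi / 12 : ℝ) * I))‖ ≤ C / r) :
    w = 0 := by
  have hw' : Differentiable ℂ (deriv w) := hw.deriv
  set L : ℝ := |a| + |c| + |lam| with hL
  have hL0 : 0 ≤ L := by positivity
  set u : ℂ := exp ((Real.pi / 12 : ℝ) * I) with hu
  have hun : ‖u‖ = 1 := norm_exp_ofReal_mul_I _
  have hconj : ∀ r : ℝ, (r : ℂ) * exp ((-(Real.pi / 12) : ℝ) * I) =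
      starRingEnd ℂ (r * u) := fun r => by
    rw [map_mul, conj_ofReal, hu, ← exp_conj, map_mul, conj_ofReal, conj_I, ofReal_neg, neg_mul,
      mul_neg]
  have hgrow := max_norm_le_exp_of_quartic hw hode (K := 1 + (1 + L)) (by linarith)
    norm_quartic_le
  have hbound : ∀ f : ℂ → ℂ, Differentiable ℂ f → ∀ j : ℕ, j ≤ 5 →
      (∀ z, ‖f (starRingEnd ℂ z)‖ = ‖f z‖) →
      (∀ z, ‖f z‖ ≤ max ‖w 0‖ ‖deriv w 0‖ * Real.exp ((1 + (1 + L)) * (1 + ‖z‖) ^ 5)) →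
      (∀ r : ℝ, T ≤ r → ‖f (r * u)‖ ≤ C / r ^ j) →
      ∃ M, ∀ x : ℝ, 0 < x → ‖f x‖ ≤ M / x ^ j := by
    intro f hf j hj hfs hfg hfd
    let F : ℂ → ℂ := fun z => z ^ j * f z
    have hF : Differentiable ℂ F := by fun_prop
    obtain ⟨M, hM⟩ := exists_bound_on_ray hF.continuous (u := u) (T := T) (M := C) (by
      intro r hr
      have hr0 : 0 < r := by linarith
      have h := hfd r hr
      rw [le_div_iff₀ (by positivity)] at h
      simp only [F, norm_mul, norm_pow, hun, norm_real, Real.norm_eq_abs, abs_of_pos hr0, mul_one]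
      linarith)
    refine ⟨M, fun x hx => ?_⟩
    have := norm_le_of_sector hF (A := max ‖w 0‖ ‖deriv w 0‖) (B := 1 + (1 + L) + 1)
      (by positivity) (by positivity) (fun z => by
        simp only [F, norm_mul, norm_pow]
        exact pow_mul_exp_le hj (norm_nonneg z) (by positivity) (hfg z)) hM
      (fun r hr => by
        rw [hconj]
        simp only [F, norm_mul, norm_pow, hfs, RCLike.norm_conj]
        simpa only [F, norm_mul, norm_pow] using hM r hr) hx
    rw [le_div_iff₀ (by positivity)]
    simp only [F, norm_mul, norm_pow, norm_real, Real.norm_eq_abs, abs_of_pos hx] at this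
    linarith
  have hnorm : ∀ {f : ℂ → ℂ}, (∀ z, starRingEnd ℂ (f (starRingEnd ℂ z)) = k * f z) →
      ∀ z, ‖f (starRingEnd ℂ z)‖ = ‖f z‖ := fun {f} h z => by
    rw [← RCLike.norm_conj (f (starRingEnd ℂ z)), h z, norm_mul, hk, one_mul]
  obtain ⟨M₁, hM₁⟩ := hbound w hw 3 (by norm_num) (hnorm hsym)
    (fun z => (le_max_left _ _).trans (hgrow z)) hdec
  obtain ⟨M₂, hM₂⟩ := hbound (deriv w) hw' 1 (by norm_num) (hnorm (deriv_conj_eq hw hsym))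
    (fun z => (le_max_right _ _).trans (hgrow z)) (by simpa using hdec')
  have hg0 : ∀ x : ℝ, L + 1 ≤ x → 0 < x ^ 4 - a * x ^ 2 - c * x - lam := fun x hx => by
    have h1 : a * x ^ 2 ≤ |a| * x ^ 2 := by gcongr; exact le_abs_self a
    have hx1 : 1 ≤ x := by linarith
    have h2 : c * x ≤ |c| * x ^ 2 := by
      have hxx : x ≤ x ^ 2 := by nlinarith
      calc c * x ≤ |c| * x := by gcongr; exact le_abs_self c
        _ ≤ |c| * x ^ 2 := by gcongr
    have h3 : lam ≤ |lam| * x ^ 2 :=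
      (le_abs_self lam).trans (le_mul_of_one_le_right (abs_nonneg lam) (one_le_pow₀ hx1))
    have h4 : L * x ^ 2 < x ^ 4 := by
      have : L < x ^ 2 := by nlinarith
      have hx2 : 0 < x ^ 2 := by nlinarith
      nlinarith
    rw [hL] at h4
    linarith
  refine eq_zero_of_energy_tendsto_zero hw (by fun_prop) hode (X := L + 1)
    (g := fun x => x ^ 4 - a * x ^ 2 - c * x - lam)
    (g' := fun x => 4 * x ^ 3 - a * (2 * x) - c) (fun x => by push_cast; ring) (fun x => ?_)
    hg0 (fun x hx => ?_) ?_
  · have := ((((hasDerivAt_pow 4 x).sub ((hasDerivAt_pow 2 x).const_mul a)).sub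
      ((hasDerivAt_id x).const_mul c)).sub_const lam)
    refine this.congr_deriv ?_
    norm_num
  · have h1 : a * (2 * x) ≤ |a| * (2 * x) := by
      have := le_abs_self a
      nlinarith
    have h2 : c ≤ |c| * (2 * x) := by
      have := le_abs_self c
      have := abs_nonneg c
      nlinarith
    have h3 : 0 ≤ |lam| * (2 * x) := by
      have : 0 ≤ 2 * x := by linarith
      positivity
    have h4 : L * (2 * x) ≤ 4 * x ^ 3 := by
      have : L ≤ 2 * x ^ 2 := by nlinarith
      nlinarith
    rw [hL] at h4
    linarith
  · refine squeeze_zero' ?_ ?_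
      (tendsto_const_div_sq_atTop (M₂ ^ 2 + (1 + (1 + L)) * 16 * M₁ ^ 2))
    · filter_upwards [eventually_ge_atTop (L + 1)] with x hx
      have := (hg0 x hx).le
      positivity
    · filter_upwards [eventually_ge_atTop (L + 1)] with x hx
      have hx1 : 1 ≤ x := by linarith
      have hx0 : 0 < x := by linarith
      have h1 := hM₁ x hx0
      have h2 := hM₂ x hx0
      have h3 : x ^ 4 - a * x ^ 2 - c * x - lam ≤ (1 + (1 + L)) * 16 * x ^ 4 := by
        have h := norm_quartic_le (a := a) (c := c) (lam := lam) (x : ℂ)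
        have h4 : -(x : ℂ) ^ 4 + (a : ℂ) * x ^ 2 + (c : ℂ) * x + (lam : ℂ) =
          ((-(x ^ 4 - a * x ^ 2 - c * x - lam) : ℝ) : ℂ) := by push_cast; ring
        rw [h4, norm_real, norm_real, Real.norm_eq_abs, Real.norm_eq_abs, abs_neg,
          abs_of_pos hx0] at h
        calc _ ≤ (1 + (1 + L)) * (1 + x) ^ 4 := (le_abs_self _).trans h
          _ ≤ (1 + (1 + L)) * (2 * x) ^ 4 := by gcongr; linarith
          _ = _ := by ring
      calc ‖deriv w x‖ ^ 2 + (x ^ 4 - a * x ^ 2 - c * x - lam) * ‖w x‖ ^ 2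
          ≤ (M₂ / x ^ 1) ^ 2 + (1 + (1 + L)) * 16 * x ^ 4 * (M₁ / x ^ 3) ^ 2 := by gcongr
        _ = _ := by field_simp

/-- A solution of the normal-form quartic that is symmetric about the real axis and has no zeros
in the upper half-plane near infinity decays along the positive imaginary axis. -/
lemma tendsto_zero_on_imaginary_axis (hw0 : w ≠ 0) (hw : Differentiable ℂ w)
    (hode : ∀ z : ℂ, deriv (deriv w) z =
      (-z ^ 4 + (a : ℂ) * z ^ 2 + (c : ℂ) * z + (lam : ℂ)) * w z) {k : ℂ} (hk : ‖k‖ = 1)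
    (hsym : ∀ z, starRingEnd ℂ (w (starRingEnd ℂ z)) = k * w z) {R : ℝ}
    (hne : ∀ z : ℂ, 0 < z.im → R < ‖z‖ → w z ≠ 0) :
    Tendsto (fun t : ℝ => w ((t : ℂ) * I)) atTop (nhds 0) := by
  have hpi := Real.pi_pos
  set L : ℝ := |a| + |c| + |lam| with hL
  have hL0 : 0 ≤ L := by positivity
  obtain ⟨R', hR', hwne, hdich⟩ := logDeriv_dichotomy hw hode (K := 1 + (1 + L)) (by linarith)
    norm_quartic_le
    (fun z => (norm_quartic_add_pow_le z).trans
      (mul_le_mul_of_nonneg_right (by linarith) (by positivity))) hne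
    (θ₀ := Real.pi / 12) (by linarith)
  rcases hdich with h | h
  · exfalso
    have hmem : Real.pi / 12 ∈ Set.Icc (Real.pi / 12) (Real.pi / 2) := ⟨le_rfl, by linarith⟩
    replace h : ∀ r : ℝ, R' ≤ r → _ := fun r hr => h r (Real.pi / 12) hr hmem
    replace hwne : ∀ r : ℝ, R' ≤ r → _ := fun r hr => hwne r (Real.pi / 12) hr hmem
    set u : ℂ := exp ((Real.pi / 12 : ℝ) * I) with hu
    have hun : ‖u‖ = 1 := norm_exp_ofReal_mul_I _
    have hune : u ≠ 0 := exp_ne_zero _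
    have hu3 : u ^ 3 = exp ((Real.pi / 4 : ℝ) * I) := by
      rw [hu, ← exp_nat_mul]; congr 1; push_cast; ring
    obtain ⟨C, hC, hdec⟩ := norm_le_div_pow_of_re_logDeriv_le hw (u := u) (R := R') hwne
      (fun t ht => by
        have ht0 : (t : ℂ) ≠ 0 := by
          rw [ofReal_ne_zero]; linarith
        set x := deriv w (t * u) / w (t * u) / (t * u) ^ 2 with hx
        have h1 : u * (deriv w (t * u) / w (t * u)) = ((t ^ 2 : ℝ) : ℂ) * (u ^ 3 * x) := by
          rw [hx]; push_cast; field_simp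
        have h2 : (u ^ 3 * (x - I)).re ≤ 1 / 2 := by
          refine (re_le_norm _).trans ?_
          rw [norm_mul, norm_pow, hun, one_pow, one_mul]
          exact h t ht
        have h3 : (u ^ 3 * I).re = -(Real.sqrt 2 / 2) := by
          rw [hu3, mul_I_re, exp_ofReal_mul_I_im, Real.sin_pi_div_four]
        have h4 : (7 / 5 : ℝ) ≤ Real.sqrt 2 := Real.le_sqrt_of_sq_le (by norm_num)
        rw [mul_sub, sub_re, h3] at h2
        rw [h1, re_ofReal_mul]
        nlinarith [sq_nonneg t])
    refine hw0 (eq_zero_of_decay_on_ray hw hode hk hsym (T := max R' 4) (C := 2 * C)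
      (by linarith [le_max_right R' 4]) (fun r hr => ?_) (fun r hr => ?_))
    · have hr1 : 1 ≤ r := by linarith [le_max_right R' 4]
      refine (hdec r hr).trans ?_
      gcongr
      · linarith
      · norm_num
    · have hr4 : 4 ≤ r := (le_max_right R' 4).trans hr
      have hrR : R' ≤ r := (le_max_left R' 4).trans hr
      have hr0 : (r : ℂ) ≠ 0 := by
        rw [ofReal_ne_zero]; linarith
      have h1 := hdec r hr
      set x := deriv w (r * u) / w (r * u) / (r * u) ^ 2 with hx
      have h2 : ‖x‖ ≤ 3 / 2 := by
        have := norm_le_norm_sub_add x I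
        have h3 := h r hrR
        rw [← hx] at h3
        rw [norm_I] at this
        linarith
      have h3 : deriv w (r * u) = (r * u) ^ 2 * x * w (r * u) := by
        have := hwne r hrR
        rw [hx]; field_simp
      change ‖deriv w (r * u)‖ ≤ _
      rw [h3, norm_mul, norm_mul, norm_pow, norm_mul, hun, mul_one, norm_real, Real.norm_eq_abs,
        abs_of_nonneg (by linarith)]
      calc r ^ 2 * ‖x‖ * ‖w (r * u)‖ ≤ r ^ 2 * 2 * (C / r ^ 6) := by gcongr; linarith
        _ = 2 * C / r * (1 / r ^ 3) := by field_simp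
        _ ≤ 2 * C / r * 1 := by
          gcongr
          rw [div_le_one (by positivity)]
          exact one_le_pow₀ (by linarith)
        _ = _ := mul_one _
  · have hmem : Real.pi / 2 ∈ Set.Icc (Real.pi / 12) (Real.pi / 2) := ⟨by linarith, le_rfl⟩
    have hI : exp ((Real.pi / 2 : ℝ) * I) = I := by
      push_cast; exact exp_pi_div_two_mul_I
    replace h : ∀ r : ℝ, R' ≤ r → _ := fun r hr => h r (Real.pi / 2) hr hmem
    replace hwne : ∀ r : ℝ, R' ≤ r → _ := fun r hr => hwne r (Real.pi / 2) hr hmem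
    simp only [hI] at h hwne
    obtain ⟨C, hC, hdec⟩ := norm_le_div_pow_of_re_logDeriv_le hw (u := I) (R := R') hwne
      (fun t ht => by
        have ht0 : (t : ℂ) ≠ 0 := by
          rw [ofReal_ne_zero]; linarith
        set x := deriv w (t * I) / w (t * I) / (t * I) ^ 2 with hx
        have h1 : I * (deriv w (t * I) / w (t * I)) = ((t ^ 2 : ℝ) : ℂ) * (-I * x) := by
          have hI3 : I ^ 3 = -I := I_pow_three
          rw [hx, ← hI3]; push_cast; field_simp
        have h2 := (im_le_norm _).trans (h t ht)
        rw [← hx, add_im, I_im] at h2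
        rw [h1, re_ofReal_mul, neg_mul, neg_re, I_mul_re]
        nlinarith [sq_nonneg t])
    refine squeeze_zero_norm' ?_ (tendsto_const_div_sq_atTop C)
    filter_upwards [eventually_ge_atTop (max R' 4)] with t ht
    have ht1 : 1 ≤ t := by linarith [le_max_right R' 4]
    refine (hdec t ht).trans ?_
    gcongr
    norm_num

end NormalForm

section RealZeros

variable {w q : ℂ → ℂ}

/-- Between two real zeros of a nontrivial solution of `w'' + q w = 0`, the function `Re (u q)`
cannot be negative throughout when `Re u ≥ 0`. -/
lemma eq_zero_of_re_mul_neg (hw : Differentiable ℂ w) (hq : Continuous q)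
    (hode : ∀ z, deriv (deriv w) z = -q z * w z) {u : ℂ} (hu : 0 ≤ u.re) {x₁ x₂ : ℝ}
    (hlt : x₁ < x₂) (h₁ : w x₁ = 0) (h₂ : w x₂ = 0)
    (hneg : ∀ x ∈ Set.Icc x₁ x₂, (u * q x).re < 0) : w = 0 := by
  have hd : ∀ x : ℝ, HasDerivAt (fun x : ℝ => w x) (deriv w x) x := fun x =>
    ((hw _).hasDerivAt).comp_ofReal
  have hd2 : ∀ x : ℝ, HasDerivAt (fun x : ℝ => deriv w x) (deriv (deriv w) x) x := fun x =>
    ((hw.deriv _).hasDerivAt).comp_ofReal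
  let G : ℝ → ℝ := fun x => inner ℝ (w x) (u * deriv w x)
  have hG : ∀ x : ℝ, HasDerivAt G
      (u.re * ‖deriv w x‖ ^ 2 - (u * q x).re * ‖w x‖ ^ 2) x := fun x => by
    have := (hd x).inner ℝ ((hd2 x).const_mul u)
    refine HasDerivAt.congr_deriv (f := G) this ?_
    rw [hode, Complex.inner, Complex.inner, ← normSq_eq_norm_sq, ← normSq_eq_norm_sq]
    simp only [mul_re, mul_im, conj_re, conj_im, neg_re, neg_im, normSq_apply]
    ring
  have hmono : MonotoneOn G (Set.Icc x₁ x₂) := by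
    refine monotoneOn_of_deriv_nonneg (convex_Icc _ _)
      (fun t _ => (hG t).continuousAt.continuousWithinAt)
      (fun t _ => (hG t).differentiableAt.differentiableWithinAt) fun t ht => ?_
    rw [(hG t).deriv]
    have h3 := hneg t (interior_subset ht)
    have h4 : 0 ≤ u.re * ‖deriv w t‖ ^ 2 := by positivity
    nlinarith [sq_nonneg ‖w t‖]
  have hG0 : ∀ x ∈ Set.Icc x₁ x₂, G x = 0 := fun x hx => by
    have h3 := hmono (Set.left_mem_Icc.2 hlt.le) hx hx.1
    have h4 := hmono hx (Set.right_mem_Icc.2 hlt.le) hx.2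
    simp only [G, h₁, h₂, inner_zero_left] at h3 h4
    exact le_antisymm h4 h3
  have hw0 : ∀ x ∈ Set.Ioo x₁ x₂, w x = 0 := fun x hx => by
    have h3 : G =ᶠ[nhds x] fun _ => 0 := by
      filter_upwards [Ioo_mem_nhds hx.1 hx.2] with y hy
      exact hG0 y (Set.Ioo_subset_Icc_self hy)
    have h4 := ((hG x).congr_of_eventuallyEq h3.symm).unique (hasDerivAt_const x (0 : ℝ))
    have h5 := hneg x (Set.Ioo_subset_Icc_self hx)
    have h6 : 0 ≤ u.re * ‖deriv w x‖ ^ 2 := by positivity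
    have h7 : ‖w x‖ ^ 2 = 0 := by nlinarith [sq_nonneg ‖w x‖]
    simpa using h7
  obtain ⟨m, hm⟩ : (Set.Ioo x₁ x₂).Nonempty := Set.nonempty_Ioo.2 hlt
  have h3 : (fun x : ℝ => w x) =ᶠ[nhds m] fun _ => 0 := by
    filter_upwards [Ioo_mem_nhds hm.1 hm.2] with y hy
    exact hw0 y hy
  exact eq_zero_of_linear_ode hw (q := fun z => -q z) hq.neg hode (hw0 m hm)
    (((hd m).congr_of_eventuallyEq h3.symm).unique (hasDerivAt_const m (0 : ℂ)))

lemma finite_real_zeros_inter_Icc (hw0 : w ≠ 0) (hw : Differentiable ℂ w) (B : ℝ) :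
    ({x : ℝ | w x = 0} ∩ Set.Icc (-B) B).Finite := by
  by_contra hinf
  obtain ⟨x, -, hx⟩ := Set.Infinite.exists_accPt_of_subset_isCompact hinf isCompact_Icc
    Set.inter_subset_right
  refine hw0 ?_
  have h1 : ∃ᶠ y : ℝ in nhdsWithin x ({x}ᶜ : Set ℝ), w (y : ℂ) = 0 :=
    (accPt_iff_frequently_nhdsNE.1 hx).mono fun y hy => hy.1
  have h2 : Tendsto (fun y : ℝ => (y : ℂ)) (nhdsWithin x ({x}ᶜ : Set ℝ))
      (nhdsWithin (x : ℂ) ({(x : ℂ)}ᶜ : Set ℂ)) :=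
    tendsto_nhdsWithin_iff.2 ⟨continuous_ofReal.continuousAt.mono_left nhdsWithin_le_nhds, by
      filter_upwards [self_mem_nhdsWithin] with y hy
      simpa using hy⟩
  have h3 : ∃ᶠ z in nhdsWithin (x : ℂ) ({(x : ℂ)}ᶜ : Set ℂ), w z = (0 : ℂ → ℂ) z :=
    h2.frequently h1
  exact AnalyticOnNhd.eq_of_frequently_eq (𝕜 := ℂ) (hw.differentiableOn.analyticOnNhd isOpen_univ)
    (fun _ _ => analyticAt_const) h3

/-- Two real zeros near one of the ends of the real line. -/
lemma exists_real_zeros_beyond (hw0 : w ≠ 0) (hw : Differentiable ℂ w)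
    (hinf : {x : ℝ | w (x : ℂ) = 0}.Infinite) (B : ℝ) :
    ∃ x₁ x₂ : ℝ, x₁ < x₂ ∧ w x₁ = 0 ∧ w x₂ = 0 ∧ ∀ x ∈ Set.Icc x₁ x₂, B < |x| := by
  have h1 := hinf.sdiff (finite_real_zeros_inter_Icc hw0 hw B)
  have h2 : {x : ℝ | w x = 0} \ ({x : ℝ | w x = 0} ∩ Set.Icc (-B) B) ⊆
      ({x : ℝ | w x = 0} ∩ Set.Ioi B) ∪ ({x : ℝ | w x = 0} ∩ Set.Iio (-B)) := by
    rintro x ⟨hx, hx'⟩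
    by_cases hB : B < x
    · exact Or.inl ⟨hx, hB⟩
    · refine Or.inr ⟨hx, ?_⟩
      by_contra hB'
      exact hx' ⟨hx, not_lt.1 hB', not_lt.1 hB⟩
  rcases Set.infinite_union.1 (h1.mono h2) with h | h
  · obtain ⟨x, hx, y, hy, hxy⟩ := h.nontrivial.exists_lt
    exact ⟨x, y, hxy, hx.1, hy.1, fun t ht =>
      lt_of_lt_of_le (lt_of_lt_of_le hx.2 ht.1) (le_abs_self t)⟩
  · obtain ⟨x, hx, y, hy, hxy⟩ := h.nontrivial.exists_lt
    refine ⟨x, y, hxy, hx.1, hy.1, fun t ht => ?_⟩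
    have hyB : y < -B := hy.2
    linarith [ht.2, neg_le_abs t]

/-- If `w'' + P w = 0` has a nontrivial solution with infinitely many real zeros then `P` is
real. -/
lemma map_conj_eq_of_infinite_real_zeros {P : Polynomial ℂ} (hw0 : w ≠ 0)
    (hw : Differentiable ℂ w) (hode : ∀ z, deriv (deriv w) z = -P.eval z * w z)
    (hinf : {x : ℝ | w (x : ℂ) = 0}.Infinite) : P.map (starRingEnd ℂ) = P := by
  by_contra hne
  have hne' : P.map (starRingEnd ℂ) - P ≠ 0 := sub_ne_zero.2 hne
  have hPc : ∀ x : ℝ, (P.map (starRingEnd ℂ)).eval (x : ℂ) = starRingEnd ℂ (P.eval (x : ℂ)) := by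
    intro x
    have := Polynomial.eval_map_apply (p := P) (starRingEnd ℂ) (x : ℂ)
    rwa [conj_ofReal] at this
  obtain ⟨B, hB⟩ : ∃ B : ℝ, ∀ z ∈ {z | (P.map (starRingEnd ℂ) - P).IsRoot z}, ‖z‖ ≤ B :=
    (Polynomial.finite_setOfPred_isRoot hne').isBounded.exists_norm_le
  have him : ∀ x : ℝ, B < |x| → (P.eval (x : ℂ)).im ≠ 0 := fun x hx h0 => by
    have := hB x (by
      change Polynomial.IsRoot _ _
      rw [Polynomial.IsRoot, Polynomial.eval_sub, hPc, conj_eq_iff_im.2 h0, sub_self])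
    rw [norm_real, Real.norm_eq_abs] at this
    linarith
  obtain ⟨x₁, x₂, hlt, h₁, h₂, hx⟩ := exists_real_zeros_beyond hw0 hw hinf B
  have hcont : Continuous fun x : ℝ => (P.eval (x : ℂ)).im := by fun_prop
  by_cases hall : ∀ x ∈ Set.Icc x₁ x₂, 0 < (P.eval (x : ℂ)).im
  · refine hw0 (eq_zero_of_re_mul_neg hw P.continuous hode (u := I) (by simp) hlt h₁ h₂
      fun x hx => ?_)
    simpa using hall x hx
  · push Not at hall
    obtain ⟨y, hy, hy0⟩ := hall
    refine hw0 (eq_zero_of_re_mul_neg hw P.continuous hode (u := -I) (by simp) hlt h₁ h₂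
      fun t ht => ?_)
    have h3 : (P.eval (t : ℂ)).im < 0 := by
      by_contra hcon
      obtain ⟨s, hs, hs0⟩ := isPreconnected_Icc.intermediate_value hy ht hcont.continuousOn
        ⟨hy0, not_lt.1 hcon⟩
      exact him s (hx s hs) hs0
    simpa using h3

/-- A solution with a real zero of an equation with real coefficients is symmetric about the real
axis up to a unimodular constant. -/
lemma exists_conj_eq_const_mul (hw0 : w ≠ 0) (hw : Differentiable ℂ w) (hq : Continuous q)
    (hode : ∀ z, deriv (deriv w) z = q z * w z)
    (hqc : ∀ z, starRingEnd ℂ (q (starRingEnd ℂ z)) = q z) {x : ℝ} (hx : w x = 0) :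
    ∃ k : ℂ, ‖k‖ = 1 ∧ ∀ z, starRingEnd ℂ (w (starRingEnd ℂ z)) = k * w z := by
  have hx' : deriv w x ≠ 0 := fun h => hw0 (eq_zero_of_linear_ode hw hq hode hx h)
  set k : ℂ := starRingEnd ℂ (deriv w x) / deriv w x with hk
  refine ⟨k, by rw [hk, norm_div, RCLike.norm_conj, div_self (norm_ne_zero_iff.2 hx')], ?_⟩
  have hconj : ∀ {f : ℂ → ℂ}, Differentiable ℂ f → ∀ z,
      HasDerivAt (fun z => starRingEnd ℂ (f (starRingEnd ℂ z)))
        (starRingEnd ℂ (deriv f (starRingEnd ℂ z))) z := fun {f} hf z => by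
    have := ((hf (starRingEnd ℂ z)).hasDerivAt).conj_conj
    rwa [conj_conj] at this
  let v : ℂ → ℂ := fun z => starRingEnd ℂ (w (starRingEnd ℂ z)) - k * w z
  have hv : ∀ z, HasDerivAt v
      (starRingEnd ℂ (deriv w (starRingEnd ℂ z)) - k * deriv w z) z := fun z =>
    (hconj hw z).sub ((hw z).hasDerivAt.const_mul k)
  have hv' : deriv v = fun z => starRingEnd ℂ (deriv w (starRingEnd ℂ z)) - k * deriv w z :=
    funext fun z => (hv z).deriv
  have hv0 : v = 0 := by
    refine eq_zero_of_linear_ode (z₀ := (x : ℂ)) (fun z => (hv z).differentiableAt) hq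
      (fun z => ?_) ?_ ?_
    · have h : HasDerivAt (deriv v) (starRingEnd ℂ (deriv (deriv w) (starRingEnd ℂ z))
          - k * deriv (deriv w) z) z := by
        rw [hv']
        exact (hconj hw.deriv z).sub ((hw.deriv z).hasDerivAt.const_mul k)
      rw [h.deriv, hode, hode, map_mul, hqc]
      simp only [v]; ring
    · simp [v, hx]
    · simp only [hv', conj_ofReal, hk, div_mul_cancel₀ _ hx', sub_self]
  intro z
  exact sub_eq_zero.1 (congrFun hv0 z)

end RealZeros

lemma quartic_eval_eq {P : Polynomial ℂ} (hdeg : P.degree = 4) (z : ℂ) :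
    P.eval z = P.coeff 4 * z ^ 4 + P.coeff 3 * z ^ 3 + P.coeff 2 * z ^ 2 + P.coeff 1 * z
      + P.coeff 0 := by
  rw [Polynomial.eval_eq_sum_range, Polynomial.natDegree_eq_of_degree_eq_some hdeg]
  simp [Finset.sum_range_succ]
  ring

/-- A real quartic potential whose equation has a nontrivial solution with infinitely many real
zeros has positive leading coefficient. -/
lemma leadingCoeff_pos_of_infinite_real_zeros {w : ℂ → ℂ} {r₀ r₁ r₂ r₃ r₄ : ℝ} (hr : r₄ ≠ 0)
    (hw0 : w ≠ 0) (hw : Differentiable ℂ w)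
    (hode : ∀ z, deriv (deriv w) z =
      -((r₄ : ℂ) * z ^ 4 + r₃ * z ^ 3 + r₂ * z ^ 2 + r₁ * z + r₀) * w z)
    (hinf : {x : ℝ | w (x : ℂ) = 0}.Infinite) : 0 < r₄ := by
  by_contra hcon
  have hr4 : 0 < -r₄ := by
    rcases lt_or_gt_of_ne hr with h | h
    · linarith
    · exact absurd h hcon
  set S : ℝ := |r₃| + |r₂| + |r₁| + |r₀| with hS
  obtain ⟨x₁, x₂, hlt, h₁, h₂, hx⟩ := exists_real_zeros_beyond hw0 hw hinf (max 1 (S / -r₄))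
  refine hw0 (eq_zero_of_re_mul_neg hw (by fun_prop) hode (u := 1) (by simp) hlt h₁ h₂
    fun x hx' => ?_)
  obtain ⟨hx1, hxS⟩ := max_lt_iff.1 (hx x hx')
  rw [div_lt_iff₀ hr4] at hxS
  have hreal : (1 : ℂ) * ((r₄ : ℂ) * x ^ 4 + r₃ * x ^ 3 + r₂ * x ^ 2 + r₁ * x + r₀) =
      ((r₄ * x ^ 4 + r₃ * x ^ 3 + r₂ * x ^ 2 + r₁ * x + r₀ : ℝ) : ℂ) := by push_cast; ring
  rw [hreal, ofReal_re]
  have hmono : ∀ (r : ℝ) (j : ℕ), j ≤ 3 → r * x ^ j ≤ |r| * |x| ^ 3 := fun r j hj => by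
    calc r * x ^ j ≤ |r * x ^ j| := le_abs_self _
      _ = |r| * |x| ^ j := by rw [abs_mul, abs_pow]
      _ ≤ |r| * |x| ^ 3 := by gcongr; exact hx1.le
  have e3 := hmono r₃ 3 le_rfl
  have e2 := hmono r₂ 2 (by norm_num)
  have e1 := hmono r₁ 1 (by norm_num)
  have e0 := hmono r₀ 0 (by norm_num)
  rw [pow_one] at e1
  rw [pow_zero, mul_one] at e0
  have hx4 : x ^ 4 = |x| * |x| ^ 3 := by
    rw [← pow_succ', (by decide : Even 4).pow_abs]
  have hx3 : 0 < |x| ^ 3 := by positivity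
  have : S * |x| ^ 3 < |x| * -r₄ * |x| ^ 3 := mul_lt_mul_of_pos_right hxS hx3
  rw [hx4]
  rw [hS] at this
  linarith

lemma exists_real_coeff {P : Polynomial ℂ} (hdeg : P.degree = 4)
    (hP : P.map (starRingEnd ℂ) = P) : ∃ r₀ r₁ r₂ r₃ r₄ : ℝ, r₄ ≠ 0 ∧ ∀ z : ℂ,
      P.eval z = (r₄ : ℂ) * z ^ 4 + r₃ * z ^ 3 + r₂ * z ^ 2 + r₁ * z + r₀ := by
  have hre : ∀ i, ((P.coeff i).re : ℂ) = P.coeff i := fun i =>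
    conj_eq_iff_re.1 (by rw [← Polynomial.coeff_map, hP])
  refine ⟨(P.coeff 0).re, (P.coeff 1).re, (P.coeff 2).re, (P.coeff 3).re, (P.coeff 4).re,
    fun h => ?_, fun z => ?_⟩
  · refine Polynomial.coeff_ne_zero_of_eq_degree hdeg ?_
    rw [← hre, h, ofReal_zero]
  · simp only [hre]
    exact quartic_eval_eq hdeg z

/-- A real affine change of variable normalizing a quartic with positive leading coefficient. -/
lemma exists_affine_normal_form (r₀ r₁ r₂ r₃ : ℝ) {r₄ : ℝ} (hr : 0 < r₄) :
    ∃ α β a c lam : ℝ, α ≠ 0 ∧ ∀ z : ℂ, (α : ℂ) ^ 2 *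
      ((r₄ : ℂ) * (α * z + β) ^ 4 + r₃ * (α * z + β) ^ 3 + r₂ * (α * z + β) ^ 2
        + r₁ * (α * z + β) + r₀) = z ^ 4 - (a : ℂ) * z ^ 2 - (c : ℂ) * z - (lam : ℂ) := by
  obtain ⟨α, hα, hα6⟩ : ∃ α : ℝ, 0 < α ∧ α ^ 6 * r₄ = 1 := by
    refine ⟨r₄ ^ (-(1 / 6) : ℝ), Real.rpow_pos_of_pos hr _, ?_⟩
    rw [← Real.rpow_natCast, ← Real.rpow_mul hr.le]
    norm_num
    rw [Real.rpow_neg_one, inv_mul_cancel₀ hr.ne']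
  obtain ⟨β, hβ⟩ : ∃ β : ℝ, 4 * r₄ * β + r₃ = 0 := ⟨-r₃ / (4 * r₄), by field_simp; ring⟩
  refine ⟨α, β, -α ^ 4 * (6 * r₄ * β ^ 2 + 3 * r₃ * β + r₂),
    -α ^ 3 * (4 * r₄ * β ^ 3 + 3 * r₃ * β ^ 2 + 2 * r₂ * β + r₁),
    -α ^ 2 * (r₄ * β ^ 4 + r₃ * β ^ 3 + r₂ * β ^ 2 + r₁ * β + r₀), hα.ne', fun z => ?_⟩
  have h6 : (α : ℂ) ^ 6 * r₄ = 1 := mod_cast hα6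
  have hb : 4 * (r₄ : ℂ) * β + r₃ = 0 := mod_cast hβ
  push_cast
  linear_combination z ^ 4 * h6 + (α : ℂ) ^ 5 * z ^ 3 * hb

/-- Every quartic equation `w'' + P w = 0` possessing a solution with exactly `2n` non-real
zeros and infinitely many real zeros is brought, by a real affine change of the independent
variable, to the PT-symmetric normal form, the transformed solution being an eigenfunction
of the PT-quartic problem with exactly `2n` non-real zeros. -/
theorem quartic_hellerstein_rossi_infinite
    (P : Polynomial ℂ) (hdeg : P.degree = 4)
    (w : ℂ → ℂ) (hw0 : w ≠ 0) (hw : Differentiable ℂ w)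
    (hode : ∀ z : ℂ, deriv (deriv w) z + P.eval z * w z = 0)
    (n : ℕ)
    (hfin : {z : ℂ | w z = 0 ∧ z.im ≠ 0}.Finite)
    (hcard : {z : ℂ | w z = 0 ∧ z.im ≠ 0}.ncard = 2 * n)
    (hinf : {x : ℝ | w (x : ℂ) = 0}.Infinite) :
    ∃ (α β : ℝ) (a c lam : ℝ), α ≠ 0 ∧
      (∀ z : ℂ, (α : ℂ) ^ 2 * P.eval ((α : ℂ) * z + (β : ℂ)) =
        z ^ 4 - (a : ℂ) * z ^ 2 - (c : ℂ) * z - (lam : ℂ)) ∧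
      PTQuarticEigenfunction a c lam (fun z => w ((α : ℂ) * z + (β : ℂ))) ∧
      {z : ℂ | w ((α : ℂ) * z + (β : ℂ)) = 0 ∧ z.im ≠ 0}.Finite ∧
      {z : ℂ | w ((α : ℂ) * z + (β : ℂ)) = 0 ∧ z.im ≠ 0}.ncard = 2 * n := by
  have hode' : ∀ z, deriv (deriv w) z = -P.eval z * w z := fun z => by
    linear_combination hode z
  obtain ⟨r₀, r₁, r₂, r₃, r₄, hr4, hP⟩ := exists_real_coeff hdeg
    (map_conj_eq_of_infinite_real_zeros hw0 hw hode' hinf)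
  have hr : 0 < r₄ := leadingCoeff_pos_of_infinite_real_zeros hr4 hw0 hw
    (fun z => by rw [hode', hP]) hinf
  obtain ⟨α, β, a, c, lam, hα, hN⟩ := exists_affine_normal_form r₀ r₁ r₂ r₃ hr
  have hN' : ∀ z : ℂ, (α : ℂ) ^ 2 * P.eval ((α : ℂ) * z + (β : ℂ)) =
      z ^ 4 - (a : ℂ) * z ^ 2 - (c : ℂ) * z - (lam : ℂ) := fun z => by rw [hP, hN]
  have hαC : (α : ℂ) ≠ 0 := ofReal_ne_zero.2 hα
  set W : ℂ → ℂ := fun z => w ((α : ℂ) * z + (β : ℂ)) with hW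
  have haff : ∀ z : ℂ, HasDerivAt (fun z : ℂ => (α : ℂ) * z + β) α z := fun z => by
    simpa using ((hasDerivAt_id z).const_mul (α : ℂ)).add_const (β : ℂ)
  have hW1 : ∀ z, HasDerivAt W (α * deriv w (α * z + β)) z := fun z =>
    ((hw _).hasDerivAt.comp z (haff z)).congr_deriv (mul_comm _ _)
  have hW1' : deriv W = fun z => α * deriv w (α * z + β) := funext fun z => (hW1 z).deriv
  have hW2 : ∀ z, deriv (deriv W) z =
      (-z ^ 4 + (a : ℂ) * z ^ 2 + (c : ℂ) * z + (lam : ℂ)) * W z := fun z => by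
    have h : HasDerivAt (deriv W) (α * (deriv (deriv w) (α * z + β) * α)) z := by
      rw [hW1']
      exact ((hw.deriv _).hasDerivAt.comp z (haff z)).const_mul (α : ℂ)
    rw [h.deriv, hode']
    linear_combination -(w (α * z + β)) * hN' z
  have hWd : Differentiable ℂ W := fun z => (hW1 z).differentiableAt
  have hinj : Function.Injective fun z : ℂ => (α : ℂ) * z + β := fun x y hxy =>
    mul_left_cancel₀ hαC (add_right_cancel hxy)
  have hsurj : ∀ y : ℂ, (α : ℂ) * ((y - β) / α) + β = y := fun y => by
    field_simp
    ring
  have hW0 : W ≠ 0 := fun h => hw0 (funext fun y => by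
    have := congrFun h ((y - β) / α)
    simpa only [hW, hsurj, Pi.zero_apply] using this)
  have him : ∀ z : ℂ, ((α : ℂ) * z + β).im = α * z.im := fun z => by simp
  have himage : Set.image (fun z : ℂ => (α : ℂ) * z + β) {z : ℂ | W z = 0 ∧ z.im ≠ 0} =
      {z : ℂ | w z = 0 ∧ z.im ≠ 0} := by
    ext y
    constructor
    · rintro ⟨z, ⟨hz, hz'⟩, rfl⟩
      exact ⟨hz, by simpa only [him] using mul_ne_zero hα hz'⟩
    · rintro ⟨hy, hy'⟩
      refine ⟨(y - β) / α, ⟨by simpa only [hW, hsurj] using hy, fun h => hy' ?_⟩, hsurj y⟩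
      rw [← hsurj y, him, h, mul_zero]
  have hfinW : {z : ℂ | W z = 0 ∧ z.im ≠ 0}.Finite := by
    rw [← himage] at hfin
    exact hfin.of_finite_image hinj.injOn
  refine ⟨α, β, a, c, lam, hα, hN', ⟨hW0, hWd, hW2, ?_⟩, hfinW, ?_⟩
  · obtain ⟨x, hx⟩ := hinf.nonempty
    have hx' : W ((x - β) / α : ℝ) = 0 := by
      rw [hW]
      push_cast
      rw [hsurj]
      exact hx
    obtain ⟨k, hk, hsym⟩ := exists_conj_eq_const_mul hW0 hWd
      (q := fun z => -z ^ 4 + (a : ℂ) * z ^ 2 + (c : ℂ) * z + (lam : ℂ)) (by fun_prop) hW2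
      (fun z => by simp) hx'
    obtain ⟨R, hR⟩ := hfinW.isBounded.exists_norm_le
    have htop := tendsto_zero_on_imaginary_axis hW0 hWd hW2 hk hsym (R := R)
      fun z hz hzR h0 => (hR z ⟨h0, hz.ne'⟩).not_gt hzR
    refine ⟨htop, ?_⟩
    rw [tendsto_zero_iff_norm_tendsto_zero] at htop ⊢
    refine (htop.comp tendsto_neg_atBot_atTop).congr fun t => ?_
    have h := congrArg norm (hsym (t * I))
    rw [RCLike.norm_conj, norm_mul, hk, one_mul, map_mul, conj_ofReal, conj_I] at h
    rw [← h, Function.comp_apply, ofReal_neg, neg_mul, mul_neg]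
  · rw [← hcard, ← himage, Set.ncard_image_of_injective _ hinj]
end
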